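/- arXiv:1909.10386 — 8 statements merged into one kernel-verified Lean document; each statement's English description precedes it below -/
import Mathlib

section
/- For every integer m ≥ 2, d(m, 4m) ≤ 409; that is, there exists an integral point set of 4m points in m-dimensional Euclidean space ℝ^m whose diameter is at most 409. -/
/-- The vertex of index `i` of the prism layer at height `h`: the scaled basis vectors form a regular
simplex of side `a` in `ℝ^m`, translated by `h` along the unit normal of its hyperplane. -/
noncomputable def prismPoint (m : ℕ) (a : ℝ) (i : Fin m) (h : ℝ) : EuclideanSpace ℝ (Fin m) :=
  WithLp.toLp 2 fun k => (if k = i then a / √2 else 0) + h / √m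

lemma dist_sq_prismPoint {m : ℕ} (a : ℝ) (i j : Fin m) (h g : ℝ) :
    dist (prismPoint m a i h) (prismPoint m a j g) ^ 2 =
      (if i = j then 0 else a ^ 2) + (h - g) ^ 2 := by
  have hm : (m : ℝ) ≠ 0 := Nat.cast_ne_zero.2 (Fin.pos i).ne'
  have hsq : √(m : ℝ) ^ 2 = m := Real.sq_sqrt (Nat.cast_nonneg m)
  have hsq2 : √(2 : ℝ) ^ 2 = 2 := Real.sq_sqrt zero_le_two
  rw [EuclideanSpace.dist_eq, Real.sq_sqrt (Finset.sum_nonneg fun _ _ => sq_nonneg _)]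
  have expand : ∀ k : Fin m,
      dist (prismPoint m a i h k) (prismPoint m a j g k) ^ 2 =
        (if k = i then a ^ 2 / 2 + 2 * (a / √2) * ((h - g) / √m) -
            (if i = j then a ^ 2 else 0) else 0) +
          (if k = j then a ^ 2 / 2 - 2 * (a / √2) * ((h - g) / √m) else 0) +
          (h - g) ^ 2 / m := by
    intro k
    have key : (a / √2) ^ 2 = a ^ 2 / 2 := by rw [div_pow, hsq2]
    have key' : ((h - g) / √m) ^ 2 = (h - g) ^ 2 / m := by rw [div_pow, hsq]
    rw [Real.dist_eq, sq_abs, ← key']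
    simp only [prismPoint]
    have hdiv : (h - g) / √m = h / √m - g / √m := sub_div _ _ _
    rw [hdiv]
    split_ifs <;> first | (exfalso; simp_all; done) | linear_combination key |
      linear_combination 2 * key | ring
  rw [Finset.sum_congr rfl fun k _ => expand k, Finset.sum_add_distrib, Finset.sum_add_distrib]
  simp only [Finset.sum_ite_eq', Finset.mem_univ, if_true, Finset.sum_const, Finset.card_univ,
    Fintype.card_fin, nsmul_eq_mul, mul_div_cancel₀ _ hm]
  split_ifs <;> ring

lemma inner_prismPoint {m : ℕ} (a : ℝ) (i : Fin m) (h : ℝ) (v : EuclideanSpace ℝ (Fin m)) :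
    inner ℝ (prismPoint m a i h) v = a / √2 * v i + h / √m * ∑ k, v k := by
  simp only [PiLp.inner_apply, prismPoint, RCLike.inner_apply, conj_trivial, add_mul,
    Finset.sum_add_distrib, Finset.mul_sum, mul_comm (v _), ite_mul, zero_mul,
    Finset.sum_ite_eq', Finset.mem_univ, if_true]

/-- A set containing two layers of the prism at distinct heights affinely spans the space. -/
lemma affineSpan_eq_top_of_prismPoint_mem {m : ℕ} (hm : 0 < m) {a h g : ℝ} (ha : a ≠ 0)
    (hgh : h ≠ g) {S : Set (EuclideanSpace ℝ (Fin m))} (hS : ∀ i, prismPoint m a i h ∈ S)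
    (hS' : ∀ i, prismPoint m a i g ∈ S) : affineSpan ℝ S = ⊤ := by
  have hne : S.Nonempty := ⟨_, hS ⟨0, hm⟩⟩
  have hm' : (m : ℝ) ≠ 0 := Nat.cast_ne_zero.2 hm.ne'
  have hsqrt : √(m : ℝ) ≠ 0 := by positivity
  rw [AffineSubspace.affineSpan_eq_top_iff_vectorSpan_eq_top_of_nonempty ℝ _ _ hne,
    ← Submodule.orthogonal_eq_bot_iff, Submodule.eq_bot_iff]
  intro v hv
  have horth : ∀ p ∈ S, ∀ q ∈ S, inner ℝ p v = inner ℝ q v := fun p hp q hq => by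
    have := (Submodule.mem_orthogonal _ _).1 hv _ (vsub_mem_vectorSpan ℝ hp hq)
    rwa [vsub_eq_sub, inner_sub_left, sub_eq_zero] at this
  have hsum : ∑ k, v k = 0 := by
    have := horth _ (hS ⟨0, hm⟩) _ (hS' ⟨0, hm⟩)
    rw [inner_prismPoint, inner_prismPoint, add_right_inj] at this
    by_contra hne0
    exact hgh (by simpa [hsqrt, hne0, div_left_inj'] using this)
  have hconst : ∀ i j, v i = v j := fun i j => by
    have := horth _ (hS i) _ (hS j)
    rw [inner_prismPoint, inner_prismPoint, add_left_inj] at this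
    exact mul_left_cancel₀ (by positivity) this
  ext i
  rw [Finset.sum_congr rfl fun k _ => hconst k i] at hsum
  simpa [hm.ne'] using hsum

/-- Heights whose nonzero differences `27, 182, 209, 391` are all legs of Pythagorean triples with
other leg `120`. -/
def layerHeight : Fin 4 → ℤ := ![0, 182, 209, 391]

lemma layerHeight_injective : Function.Injective layerHeight := by decide

lemma exists_sq_eq_layerHeight_sub_sq (s t : Fin 4) :
    ∃ z : ℤ, 0 ≤ z ∧ z ≤ 391 ∧ (layerHeight s - layerHeight t) ^ 2 = z ^ 2 := by
  refine ⟨|layerHeight s - layerHeight t|, abs_nonneg _, ?_, (sq_abs _).symm⟩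
  revert s t
  decide

lemma exists_sq_eq_add_layerHeight_sub_sq (s t : Fin 4) :
    ∃ z : ℤ, 0 ≤ z ∧ z ≤ 409 ∧ 120 ^ 2 + (layerHeight s - layerHeight t) ^ 2 = z ^ 2 := by
  have hroot : ∀ s t, ∃ z ∈ ([120, 123, 218, 241, 409] : List ℤ),
      0 ≤ z ∧ z ≤ 409 ∧ 120 ^ 2 + (layerHeight s - layerHeight t) ^ 2 = z ^ 2 := by
    decide
  obtain ⟨z, -, hz⟩ := hroot s t
  exact ⟨z, hz⟩

lemma exists_int_dist_prismPoint_layerHeight {m : ℕ} (i j : Fin m) (s t : Fin 4) :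
    ∃ z : ℤ, z ≤ 409 ∧
      dist (prismPoint m 120 i (layerHeight s)) (prismPoint m 120 j (layerHeight t)) = z := by
  have hd := dist_sq_prismPoint 120 i j (layerHeight s) (layerHeight t)
  obtain ⟨z, hz0, hz, hzsq⟩ : ∃ z : ℤ, 0 ≤ z ∧ z ≤ 409 ∧
      (if i = j then 0 else 120 ^ 2) + (layerHeight s - layerHeight t) ^ 2 = z ^ 2 := by
    split_ifs
    · obtain ⟨z, hz0, hz, hzsq⟩ := exists_sq_eq_layerHeight_sub_sq s t
      exact ⟨z, hz0, by lia, by rw [zero_add, hzsq]⟩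
    · exact exists_sq_eq_add_layerHeight_sub_sq s t
  refine ⟨z, hz, (sq_eq_sq₀ dist_nonneg (by exact_mod_cast hz0)).1 ?_⟩
  rw [hd]
  exact_mod_cast hzsq

lemma prismPoint_layerHeight_injective (m : ℕ) : Function.Injective
    fun x : Fin m × Fin 4 => prismPoint m 120 x.1 (layerHeight x.2) := by
  rintro ⟨i, s⟩ ⟨j, t⟩ heq
  have hd := dist_sq_prismPoint 120 i j (layerHeight s) (layerHeight t)
  rw [dist_eq_zero.2 heq] at hd
  have hij : i = j := by
    by_contra hne
    rw [if_neg hne] at hd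
    nlinarith [sq_nonneg ((layerHeight s : ℝ) - layerHeight t)]
  rw [if_pos hij, zero_add, zero_pow two_ne_zero, eq_comm, sq_eq_zero_iff, sub_eq_zero,
    Int.cast_inj] at hd
  rw [hij, layerHeight_injective hd]

/-- For every integer `m ≥ 2`, there exists an integral point set of `4 * m` points in
`ℝ^m` (pairwise integral distances, not contained in any affine hyperplane) whose
diameter is at most `409`; that is, `d(m, 4 * m) ≤ 409`. -/
theorem d_bound_stmt_2 :
    ∀ m : ℕ, 2 ≤ m →
      ∃ S : Finset (EuclideanSpace ℝ (Fin m)),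
        S.card = 4 * m ∧
        affineSpan ℝ (S : Set (EuclideanSpace ℝ (Fin m))) = ⊤ ∧
        (∀ p ∈ S, ∀ q ∈ S, ∃ z : ℤ, dist p q = (z : ℝ)) ∧
        Metric.diam (S : Set (EuclideanSpace ℝ (Fin m))) ≤ 409 := by
  intro m hm
  let S := Finset.univ.map ⟨_, prismPoint_layerHeight_injective m⟩
  have hmem : ∀ i s, prismPoint m 120 i (layerHeight s) ∈ S := fun i s =>
    Finset.mem_map.2 ⟨(i, s), Finset.mem_univ _, rfl⟩
  have hdist : ∀ p ∈ S, ∀ q ∈ S, ∃ z : ℤ, z ≤ 409 ∧ dist p q = z := by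
    intro p hp q hq
    obtain ⟨x, -, rfl⟩ := Finset.mem_map.1 hp
    obtain ⟨y, -, rfl⟩ := Finset.mem_map.1 hq
    exact exists_int_dist_prismPoint_layerHeight _ _ _ _
  refine ⟨S, ?_, ?_, fun p hp q hq => ?_, ?_⟩
  · simp [S, mul_comm]
  · exact affineSpan_eq_top_of_prismPoint_mem (by lia) (by norm_num)
      (Int.cast_injective.ne (layerHeight_injective.ne zero_ne_one))
      (fun i => hmem i 0) (fun i => hmem i 1)
  · obtain ⟨z, -, hz⟩ := hdist p hp q hq
    exact ⟨z, hz⟩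
  · refine Metric.diam_le_of_forall_dist_le (by norm_num) fun p hp q hq => ?_
    obtain ⟨z, hle, hz⟩ := hdist p hp q hq
    rw [hz]
    exact_mod_cast hle
end

section
/- For every integer m ≥ 2, d(m, 3m + 1) ≤ 56; that is, there exists an integral point set of 3m + 1 points in m-dimensional Euclidean space ℝ^m whose diameter is at most 56. -/
/-- In `ℝ^m` there are `m` unit vectors with pairwise inner products `1 / 2`. -/
lemma exists_unit_vectors_inner_eq_half (m : ℕ) (hm : m ≠ 0) :
    ∃ u : Fin m → EuclideanSpace ℝ (Fin m),
      ∀ i j, inner ℝ (u i) (u j) = if i = j then 1 else (1 / 2 : ℝ) := by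
  obtain ⟨s, hs⟩ : ∃ s : ℝ, 2 * s + m * s ^ 2 = 1 := by
    refine ⟨(-1 + √(1 + m)) / m, ?_⟩
    have hm' : (m : ℝ) ≠ 0 := by exact_mod_cast hm
    have hsq : √(1 + (m : ℝ)) ^ 2 = 1 + m := Real.sq_sqrt (by positivity)
    field_simp
    linear_combination hsq
  refine ⟨fun i => WithLp.toLp 2 fun k => (√2)⁻¹ * ((if k = i then 1 else 0) + s), ?_⟩
  intro i j
  have h2 : (√2)⁻¹ * (√2)⁻¹ = (1 / 2 : ℝ) := by
    rw [← mul_inv, Real.mul_self_sqrt (by norm_num)]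
    norm_num
  have hterm : ∀ k : Fin m,
      (√2)⁻¹ * ((if k = j then 1 else 0) + s) * ((√2)⁻¹ * ((if k = i then 1 else 0) + s)) =
        (1 / 2 : ℝ) * ((if k = j then (if k = i then 1 else 0) else 0) +
          (if k = j then s else 0) + (if k = i then s else 0) + s ^ 2) := by
    intro k
    rw [← h2]
    split_ifs <;> ring
  simp only [PiLp.inner_apply, RCLike.inner_apply, conj_trivial, hterm, ← Finset.mul_sum,
    Finset.sum_add_distrib, Finset.sum_ite_eq', Finset.mem_univ, if_true, Finset.sum_const,
    Finset.card_univ, Fintype.card_fin, nsmul_eq_mul]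
  by_cases hij : i = j
  · simp only [hij, if_true]
    linear_combination hs / 2
  · simp only [hij, Ne.symm hij, if_false]
    linear_combination hs / 2

/-- Vectors with Gram matrix `(1 + J) / 2` are linearly independent. -/
lemma linearIndependent_of_inner_eq_half {E : Type*} [NormedAddCommGroup E]
    [InnerProductSpace ℝ E] {m : ℕ} {u : Fin m → E}
    (hu : ∀ i j, inner ℝ (u i) (u j) = if i = j then 1 else (1 / 2 : ℝ)) :
    LinearIndependent ℝ u := by
  rw [Fintype.linearIndependent_iff]
  intro c hc
  have hcoord : ∀ j, c j = -∑ i, c i := by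
    intro j
    have hinner : inner ℝ (u j) (∑ i, c i • u i) = (0 : ℝ) := by rw [hc, inner_zero_right]
    have hterm : ∀ i, c i * (if j = i then 1 else (1 / 2 : ℝ)) =
        (1 / 2) * ((if j = i then c i else 0) + c i) := by
      intro i
      split_ifs <;> ring
    simp only [inner_sum, inner_smul_right, hu, hterm, ← Finset.mul_sum,
      Finset.sum_add_distrib, Finset.sum_ite_eq, Finset.mem_univ, if_true] at hinner
    linarith
  have hsum : ∑ i, c i = m * -∑ i, c i := by
    conv_lhs => rw [Finset.sum_congr rfl fun j _ => hcoord j]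
    simp
  have hzero : (1 + (m : ℝ)) * ∑ i, c i = 0 := by linear_combination hsum
  have hpos : (1 + (m : ℝ)) ≠ 0 := by positivity
  intro j
  rw [hcoord j, (mul_eq_zero.mp hzero).resolve_left hpos, neg_zero]

lemma dist_eq_intCast_of_sq {E : Type*} [NormedAddCommGroup E] {x y : E} {z : ℤ} (hz : 0 ≤ z)
    (h : ‖x - y‖ ^ 2 = ((z ^ 2 : ℤ) : ℝ)) : dist x y = z := by
  rw [dist_eq_norm]
  refine (sq_eq_sq₀ (norm_nonneg _) (by exact_mod_cast hz)).mp ?_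
  rw [h]
  push_cast
  rfl

/-- Positions along each ray; any two `a`, `b` of them make `a² - a b + b²` a perfect square. -/
def rayPosition : Fin 3 → ℤ := ![7, 15, 40]

/-- The origin together with three points on each of the rays spanned by the `u i`. -/
noncomputable def rayPoint {E : Type*} [NormedAddCommGroup E] [InnerProductSpace ℝ E] {m : ℕ}
    (u : Fin m → E) : Option (Fin m × Fin 3) → E
  | none => 0
  | some (i, k) => (rayPosition k : ℝ) • u i

section rayPoint

variable {E : Type*} [NormedAddCommGroup E] [InnerProductSpace ℝ E] {m : ℕ} {u : Fin m → E}

lemma exists_dist_rayPoint_eq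
    (hu : ∀ i j, inner ℝ (u i) (u j) = if i = j then 1 else (1 / 2 : ℝ))
    {x y : Option (Fin m × Fin 3)} (hxy : x ≠ y) :
    ∃ z : ℤ, 0 < z ∧ z ≤ 40 ∧ dist (rayPoint u x) (rayPoint u y) = z := by
  have hnorm : ∀ i, ‖u i‖ = 1 := by
    intro i
    have h := hu i i
    rw [real_inner_self_eq_norm_sq, if_pos rfl] at h
    exact (pow_eq_one_iff_of_nonneg (norm_nonneg _) two_ne_zero).mp h
  have hrange : ∀ k, 0 < rayPosition k ∧ rayPosition k ≤ 40 := by decide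
  have horigin : ∀ i k, dist ((rayPosition k : ℝ) • u i) 0 = rayPosition k := by
    intro i k
    rw [dist_zero_right, norm_smul, hnorm, mul_one, Real.norm_of_nonneg]
    exact_mod_cast (hrange k).1.le
  have hdiff : ∀ (a b : ℤ) (i j : Fin m), ‖(a : ℝ) • u i - (b : ℝ) • u j‖ ^ 2 =
      (a : ℝ) ^ 2 - 2 * (a * b * if i = j then 1 else (1 / 2 : ℝ)) + (b : ℝ) ^ 2 := by
    intro a b i j
    rw [norm_sub_sq_real, norm_smul, norm_smul, hnorm, hnorm, real_inner_smul_left,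
      real_inner_smul_right, hu, mul_one, mul_one, Real.norm_eq_abs, Real.norm_eq_abs,
      sq_abs, sq_abs]
    ring
  match x, y with
  | none, none => exact absurd rfl hxy
  | none, some (i, k) => exact ⟨_, (hrange k).1, (hrange k).2, dist_comm (0 : E) _ ▸ horigin i k⟩
  | some (i, k), none => exact ⟨_, (hrange k).1, (hrange k).2, horigin i k⟩
  | some (i, k), some (j, l) =>
    by_cases hij : i = j
    · have hkl : k ≠ l := fun h => hxy (by rw [hij, h])
      have hsub : ∀ k l : Fin 3, k ≠ l →
          0 < |rayPosition k - rayPosition l| ∧ |rayPosition k - rayPosition l| ≤ 40 := by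
        decide
      refine ⟨|rayPosition k - rayPosition l|, (hsub k l hkl).1, (hsub k l hkl).2,
        dist_eq_intCast_of_sq (abs_nonneg _) ((hdiff _ _ i j).trans ?_)⟩
      rw [if_pos hij, sq_abs]
      push_cast
      ring
    · have hsq : ∀ k l : Fin 3, ∃ z ∈ Finset.Icc (1 : ℤ) 40,
          rayPosition k ^ 2 - rayPosition k * rayPosition l + rayPosition l ^ 2 = z ^ 2 := by
        decide
      obtain ⟨z, hz, hzsq⟩ := hsq k l
      rw [Finset.mem_Icc] at hz
      refine ⟨z, by omega, hz.2, dist_eq_intCast_of_sq (by omega) ((hdiff _ _ i j).trans ?_)⟩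
      rw [if_neg hij, ← hzsq]
      push_cast
      ring

lemma affineSpan_range_rayPoint (hspan : Submodule.span ℝ (Set.range u) = ⊤) :
    affineSpan ℝ (Set.range (rayPoint u)) = ⊤ := by
  have hzero : (0 : E) ∈ Set.range (rayPoint u) := ⟨none, rfl⟩
  rw [AffineSubspace.affineSpan_eq_top_iff_vectorSpan_eq_top_of_nonempty ℝ E E ⟨0, hzero⟩,
    eq_top_iff, ← hspan, Submodule.span_le]
  rintro _ ⟨i, rfl⟩
  have hmem : (7 : ℝ) • u i ∈ vectorSpan ℝ (Set.range (rayPoint u)) := by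
    have h := vsub_mem_vectorSpan ℝ (Set.mem_range_self (f := rayPoint u) (some (i, 0))) hzero
    simpa [rayPoint, rayPosition] using h
  simpa [smul_smul] using Submodule.smul_mem _ (7⁻¹ : ℝ) hmem

end rayPoint

/-- For every integer `m ≥ 2`, there exists an integral point set of `3 * m + 1` points in
`ℝ^m` (pairwise integral distances, not contained in any affine hyperplane) whose
diameter is at most `56`; that is, `d(m, 3 * m + 1) ≤ 56`. -/
theorem d_bound_stmt_3 :
    ∀ m : ℕ, 2 ≤ m →
      ∃ S : Finset (EuclideanSpace ℝ (Fin m)),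
        S.card = 3 * m + 1 ∧
        affineSpan ℝ (S : Set (EuclideanSpace ℝ (Fin m))) = ⊤ ∧
        (∀ p ∈ S, ∀ q ∈ S, ∃ z : ℤ, dist p q = (z : ℝ)) ∧
        Metric.diam (S : Set (EuclideanSpace ℝ (Fin m))) ≤ 56 := by
  intro m hm
  obtain ⟨u, hu⟩ := exists_unit_vectors_inner_eq_half m (by omega)
  have hinj : Function.Injective (rayPoint u) := by
    intro x y hxy
    by_contra hne
    obtain ⟨z, hz, -, hdist⟩ := exists_dist_rayPoint_eq hu hne
    rw [hxy, dist_self] at hdist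
    exact hz.ne (by exact_mod_cast hdist)
  have hdist : ∀ x y, ∃ z : ℤ, z ≤ 40 ∧ dist (rayPoint u x) (rayPoint u y) = z := by
    intro x y
    by_cases hxy : x = y
    · exact ⟨0, by norm_num, by simp [hxy]⟩
    · obtain ⟨z, -, hz⟩ := exists_dist_rayPoint_eq hu hxy
      exact ⟨z, hz⟩
  refine ⟨Finset.univ.map ⟨rayPoint u, hinj⟩, ?_, ?_, ?_, ?_⟩
  · simp [mul_comm]
  · have hspan : Submodule.span ℝ (Set.range u) = ⊤ :=
      (linearIndependent_of_inner_eq_half hu).span_eq_top_of_card_eq_finrank' (by simp)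
    simpa using affineSpan_range_rayPoint hspan
  · intro p hp q hq
    simp only [Finset.mem_map, Finset.mem_univ, true_and, Function.Embedding.coeFn_mk] at hp hq
    obtain ⟨x, rfl⟩ := hp
    obtain ⟨y, rfl⟩ := hq
    obtain ⟨z, -, hz⟩ := hdist x y
    exact ⟨z, hz⟩
  · refine Metric.diam_le_of_forall_dist_le (by norm_num) ?_
    intro p hp q hq
    simp only [Finset.coe_map, Finset.coe_univ, Set.image_univ, Set.mem_range,
      Function.Embedding.coeFn_mk] at hp hq
    obtain ⟨x, rfl⟩ := hp
    obtain ⟨y, rfl⟩ := hq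
    obtain ⟨z, hz, hzd⟩ := hdist x y
    rw [hzd]
    exact_mod_cast hz.trans (by norm_num)
end

section
/- For every integer m ≥ 2, d(m, 2m + 3) ≤ 17; that is, there exists an integral point set of 2m + 3 points in m-dimensional Euclidean space ℝ^m whose diameter is at most 17. -/
namespace IntegralPointSet

noncomputable section

/-- The point of `ℝ^(k+1)` with height `h` above the point `v` of `ℝ^k`. -/
def liftPoint {k : ℕ} (h : ℝ) (v : Fin k → ℝ) : EuclideanSpace ℝ (Fin (k + 1)) :=
  WithLp.toLp 2 (Fin.cons h v)

lemma dist_liftPoint_sq {k : ℕ} (h h' : ℝ) (v v' : Fin k → ℝ) :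
    dist (liftPoint h v) (liftPoint h' v') ^ 2 = (h - h') ^ 2 + ∑ i, (v i - v' i) ^ 2 := by
  rw [EuclideanSpace.dist_sq_eq]
  simp [liftPoint, Fin.sum_univ_succ, Real.dist_eq, sq_abs]

lemma dist_eq_natCast_of_sq {X : Type*} [PseudoMetricSpace X] {x y : X} {z : ℕ}
    (h : dist x y ^ 2 = (z : ℝ) ^ 2) : dist x y = z :=
  (sq_eq_sq₀ dist_nonneg z.cast_nonneg).1 h

lemma sum_single_sub_single_sq {k : ℕ} (s : ℝ) {a b : Fin k} (hab : a ≠ b) :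
    ∑ i, ((Pi.single a s : Fin k → ℝ) i - (Pi.single b s : Fin k → ℝ) i) ^ 2 = 2 * s ^ 2 := by
  have h : ∀ i, ((Pi.single a s : Fin k → ℝ) i - (Pi.single b s : Fin k → ℝ) i) ^ 2 =
      (if i = a then s ^ 2 else 0) + (if i = b then s ^ 2 else 0) := by
    intro i
    simp only [Pi.single_apply]
    grind
  simp only [h, Finset.sum_add_distrib, Finset.sum_ite_eq', Finset.mem_univ, if_true]
  ring

lemma sum_single_sub_const_sq {k : ℕ} (s c : ℝ) (a : Fin k) :
    ∑ i, ((Pi.single a s : Fin k → ℝ) i - c) ^ 2 = s ^ 2 - 2 * s * c + k * c ^ 2 := by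
  have h : ∀ i, ((Pi.single a s : Fin k → ℝ) i - c) ^ 2 =
      (if i = a then s ^ 2 - 2 * s * c else 0) + c ^ 2 := by
    intro i
    simp only [Pi.single_apply]
    grind
  simp [h, Finset.sum_add_distrib]

/-- Heights of the five points above the apex. -/
def apexHeight : Fin 5 → ℝ := ![-13 / 2, -3 / 2, 3 / 2, 13 / 2, 19 / 2]

/-- The two heights of the points above each vertex of the simplex. -/
def baseHeight : Fin 2 → ℝ := ![0, 8]

/-- Two points above each vertex `s • e i` of a regular simplex, and five points above the
apex `(c, …, c)`. -/
def config {k : ℕ} (s c : ℝ) : (Fin 2 × Fin k) ⊕ Fin 5 → EuclideanSpace ℝ (Fin (k + 1))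
  | .inl (b, i) => liftPoint (baseHeight b) (Pi.single i s)
  | .inr t => liftPoint (apexHeight t) fun _ => c

lemma exists_natCast_sq_apexHeight_sub {t u : Fin 5} (h : t ≠ u) :
    ∃ z : ℕ, 0 < z ∧ z ≤ 17 ∧ (apexHeight t - apexHeight u) ^ 2 = (z : ℝ) ^ 2 := by
  refine ⟨(!![0, 5, 8, 13, 16; 5, 0, 3, 8, 11; 8, 3, 0, 5, 8; 13, 8, 5, 0, 3;
    16, 11, 8, 3, 0] : Matrix (Fin 5) (Fin 5) ℕ) t u, ?_⟩
  fin_cases t <;> fin_cases u <;> first | exact absurd rfl h | norm_num [apexHeight]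

lemma exists_natCast_sq_base_apex (b : Fin 2) (t : Fin 5) :
    ∃ z : ℕ, 0 < z ∧ z ≤ 17 ∧
      (baseHeight b - apexHeight t) ^ 2 + 315 / 4 = (z : ℝ) ^ 2 := by
  refine ⟨(!![11, 9, 9, 11, 13; 17, 13, 11, 9, 9] : Matrix (Fin 2) (Fin 5) ℕ) b t, ?_⟩
  fin_cases b <;> fin_cases t <;> norm_num [apexHeight, baseHeight]

lemma exists_natCast_dist_base_apex {k : ℕ} {s c : ℝ} (hs : s ^ 2 = 18)
    (hc : k * c ^ 2 - 2 * s * c = 243 / 4) (p : Fin 2 × Fin k) (t : Fin 5) :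
    ∃ z : ℕ, 0 < z ∧ z ≤ 17 ∧ dist (config s c (.inl p)) (config s c (.inr t)) = z := by
  obtain ⟨z, hz, hz', h⟩ := exists_natCast_sq_base_apex p.1 t
  refine ⟨z, hz, hz', dist_eq_natCast_of_sq ?_⟩
  rw [← h, config, config, dist_liftPoint_sq, sum_single_sub_const_sq]
  linarith

lemma exists_natCast_dist_config {k : ℕ} {s c : ℝ} (hs : s ^ 2 = 18)
    (hc : k * c ^ 2 - 2 * s * c = 243 / 4) {x y : (Fin 2 × Fin k) ⊕ Fin 5} (hxy : x ≠ y) :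
    ∃ z : ℕ, 0 < z ∧ z ≤ 17 ∧ dist (config s c x) (config s c y) = z := by
  rcases x with ⟨b, i⟩ | t <;> rcases y with ⟨b', j⟩ | u
  · by_cases hij : i = j
    · subst hij
      have hb : b ≠ b' := by rintro rfl; exact hxy rfl
      refine ⟨8, by norm_num, by norm_num, dist_eq_natCast_of_sq ?_⟩
      rw [config, config, dist_liftPoint_sq]
      fin_cases b <;> fin_cases b' <;> first | exact absurd rfl hb | norm_num [baseHeight]
    · by_cases hb : b = b'
      · refine ⟨6, by norm_num, by norm_num, dist_eq_natCast_of_sq ?_⟩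
        rw [config, config, dist_liftPoint_sq, sum_single_sub_single_sq s hij, hs, hb]
        norm_num
      · refine ⟨10, by norm_num, by norm_num, dist_eq_natCast_of_sq ?_⟩
        rw [config, config, dist_liftPoint_sq, sum_single_sub_single_sq s hij, hs]
        fin_cases b <;> fin_cases b' <;> first | exact absurd rfl hb | norm_num [baseHeight]
  · exact exists_natCast_dist_base_apex hs hc _ _
  · rw [dist_comm]
    exact exists_natCast_dist_base_apex hs hc _ _
  · obtain ⟨z, hz, hz', h⟩ := exists_natCast_sq_apexHeight_sub (t := t) (u := u)
      (by rintro rfl; exact hxy rfl)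
    refine ⟨z, hz, hz', dist_eq_natCast_of_sq ?_⟩
    rw [← h, config, config, dist_liftPoint_sq]
    simp

lemma config_injective {k : ℕ} {s c : ℝ} (hs : s ^ 2 = 18)
    (hc : k * c ^ 2 - 2 * s * c = 243 / 4) : Function.Injective (config (k := k) s c) := by
  intro x y hxy
  by_contra hne
  obtain ⟨z, hz, -, h⟩ := exists_natCast_dist_config hs hc hne
  rw [hxy, dist_self] at h
  exact hz.ne (by exact_mod_cast h)

lemma inner_liftPoint {k : ℕ} (h : ℝ) (v : Fin k → ℝ) (x : EuclideanSpace ℝ (Fin (k + 1))) :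
    inner ℝ (liftPoint h v) x = h * x 0 + ∑ i, v i * x i.succ := by
  simp [liftPoint, PiLp.inner_apply, Fin.sum_univ_succ, mul_comm]

lemma affineSpan_range_config {k : ℕ} (hk : 0 < k) {s c : ℝ} (hs : s ≠ 0) (hsc : k * c ≠ s) :
    affineSpan ℝ (Set.range (config (k := k) s c)) = ⊤ := by
  rw [← AffineSubspace.direction_eq_top_iff_of_nonempty
    ((Set.range_nonempty _).mono (subset_affineSpan ℝ _)), ← Submodule.orthogonal_eq_bot_iff,
    Submodule.eq_bot_iff]
  intro x hx
  have key : ∀ p q, inner ℝ (config s c p) x = inner ℝ (config s c q) x := by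
    intro p q
    have h := (Submodule.mem_orthogonal _ x).1 hx _ (AffineSubspace.vsub_mem_direction
      (mem_affineSpan ℝ (Set.mem_range_self p)) (mem_affineSpan ℝ (Set.mem_range_self q)))
    rwa [vsub_eq_sub, inner_sub_left, sub_eq_zero] at h
  have h0 : x 0 = 0 := by
    have h := key (.inl (0, ⟨0, hk⟩)) (.inl (1, ⟨0, hk⟩))
    simp only [config, inner_liftPoint, baseHeight] at h
    simpa using h
  have hi : ∀ i : Fin k, s * x i.succ = c * ∑ j : Fin k, x j.succ := by
    intro i
    have h := key (.inl (0, i)) (.inr 0)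
    simpa [config, inner_liftPoint, h0, Pi.single_apply, Finset.mul_sum] using h
  have hsum : ∑ j : Fin k, x j.succ = 0 := by
    have h : ∑ i : Fin k, s * x i.succ = ∑ _i : Fin k, c * ∑ j : Fin k, x j.succ :=
      Finset.sum_congr rfl fun i _ => hi i
    rw [← Finset.mul_sum, Finset.sum_const, Finset.card_univ, Fintype.card_fin,
      nsmul_eq_mul, ← mul_assoc] at h
    by_contra hne
    exact hsc (mul_right_cancel₀ hne h).symm
  ext i
  refine Fin.cases h0 (fun j => ?_) i
  simpa [hsum, hs] using hi j

lemma exists_apex_coord {k : ℕ} (hk : 0 < k) (s : ℝ) :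
    ∃ c : ℝ, k * c ^ 2 - 2 * s * c = 243 / 4 := by
  have hk' : (k : ℝ) ≠ 0 := by positivity
  have hr := Real.sq_sqrt (show 0 ≤ s ^ 2 + k * (243 / 4) by positivity)
  refine ⟨(s + √(s ^ 2 + k * (243 / 4))) / k, ?_⟩
  generalize √(s ^ 2 + k * (243 / 4)) = r at hr ⊢
  field_simp
  linarith

end

end IntegralPointSet

/-- For every integer `m ≥ 2`, there exists an integral point set of `2 * m + 3` points in
`ℝ^m` (pairwise integral distances, not contained in any affine hyperplane) whose
diameter is at most `17`; that is, `d(m, 2 * m + 3) ≤ 17`. -/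
theorem d_bound_stmt_5 :
    ∀ m : ℕ, 2 ≤ m →
      ∃ S : Finset (EuclideanSpace ℝ (Fin m)),
        S.card = 2 * m + 3 ∧
        affineSpan ℝ (S : Set (EuclideanSpace ℝ (Fin m))) = ⊤ ∧
        (∀ p ∈ S, ∀ q ∈ S, ∃ z : ℤ, dist p q = (z : ℝ)) ∧
        Metric.diam (S : Set (EuclideanSpace ℝ (Fin m))) ≤ 17 := by
  open IntegralPointSet in
  intro m hm
  obtain ⟨k, rfl⟩ : ∃ k, m = k + 1 := ⟨m - 1, by omega⟩
  have hk : 0 < k := by omega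
  obtain ⟨s, hs⟩ : ∃ s : ℝ, s ^ 2 = 18 := ⟨√18, Real.sq_sqrt (by norm_num)⟩
  obtain ⟨c, hc⟩ := exists_apex_coord hk s
  have hs0 : s ≠ 0 := by rintro rfl; norm_num at hs
  have hsc : k * c ≠ s := by
    intro h
    have hk' : (0 : ℝ) < k := by exact_mod_cast hk
    have : (k : ℝ) * (243 / 4) = -18 := by
      rw [← hc, ← hs, ← h]
      ring
    linarith
  refine ⟨Finset.univ.map ⟨config s c, config_injective hs hc⟩, ?_, ?_, ?_, ?_⟩
  · simp
    ring
  · simpa using affineSpan_range_config hk hs0 hsc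
  · simp only [Finset.mem_map, Finset.mem_univ, true_and, Function.Embedding.coeFn_mk]
    rintro _ ⟨x, rfl⟩ _ ⟨y, rfl⟩
    by_cases hxy : x = y
    · exact ⟨0, by simp [hxy]⟩
    · obtain ⟨z, -, -, h⟩ := exists_natCast_dist_config hs hc hxy
      exact ⟨z, by simpa using h⟩
  · refine Metric.diam_le_of_forall_dist_le (by norm_num) ?_
    simp only [Finset.coe_map, Finset.coe_univ, Set.image_univ, Function.Embedding.coeFn_mk]
    rintro _ ⟨x, rfl⟩ _ ⟨y, rfl⟩
    by_cases hxy : x = y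
    · simp [hxy]
    · obtain ⟨z, -, hz, h⟩ := exists_natCast_dist_config hs hc hxy
      rw [h]
      exact_mod_cast hz
end

section
/- For every integer m ≥ 2, d(m, 2m + 5) ≤ 158; that is, there exists an integral point set of 2m + 5 points in m-dimensional Euclidean space ℝ^m whose diameter is at most 158. -/
open scoped RealInnerProductSpace

/-- In `ℝ^(k+1)` there are a unit vector `n` and `k` vectors orthogonal to it, all of length `15`
and with pairwise inner products `63`, which together span the space. -/
theorem exists_spanning_equiangular (k : ℕ) :
    ∃ (n : EuclideanSpace ℝ (Fin (k + 1))) (x : Fin k → EuclideanSpace ℝ (Fin (k + 1))),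
      ⟪n, n⟫ = 1 ∧ (∀ i, ⟪n, x i⟫ = 0) ∧
      (∀ i j, ⟪x i, x j⟫ = if i = j then 225 else 63) ∧
      Submodule.span ℝ (insert n (Set.range x)) = ⊤ := by
  obtain ⟨a, ha, ha2⟩ : ∃ a : ℝ, 0 < a ∧ a ^ 2 = 162 :=
    ⟨√162, by positivity, Real.sq_sqrt (by norm_num)⟩
  obtain ⟨b, hb, hb2⟩ : ∃ b : ℝ, 0 ≤ b ∧ k * b ^ 2 + 2 * a * b = 63 := by
    have hcont : ContinuousOn (fun b : ℝ => k * b ^ 2 + 2 * a * b) (Set.Icc 0 (63 / (2 * a))) := by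
      fun_prop
    have hmem : (63 : ℝ) ∈ Set.Icc ((k : ℝ) * 0 ^ 2 + 2 * a * 0)
        (k * (63 / (2 * a)) ^ 2 + 2 * a * (63 / (2 * a))) := by
      have h : 2 * a * (63 / (2 * a)) = 63 := by field_simp
      rw [h]
      constructor
      · norm_num
      · have : 0 ≤ (k : ℝ) * (63 / (2 * a)) ^ 2 := by positivity
        linarith
    obtain ⟨b, hb, h⟩ := intermediate_value_Icc (by positivity) hcont hmem
    exact ⟨b, hb.1, h⟩
  let e : Fin (k + 1) → EuclideanSpace ℝ (Fin (k + 1)) := fun i => EuclideanSpace.single i 1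
  have he : ∀ i j, ⟪e i, e j⟫ = if i = j then 1 else 0 :=
    orthonormal_iff_ite.1 (EuclideanSpace.orthonormal_single)
  let s := ∑ j : Fin k, e j.succ
  have hes : ∀ i : Fin k, ⟪e i.succ, s⟫ = 1 := fun i => by simp [s, inner_sum, he]
  have hse : ∀ i : Fin k, ⟪s, e i.succ⟫ = 1 := fun i => by rw [real_inner_comm, hes]
  have hss : ⟪s, s⟫ = k := by
    rw [show ⟪s, s⟫ = ∑ j : Fin k, ⟪e j.succ, s⟫ from sum_inner _ _ _]
    simp [hes]
  have h0s : ⟪e 0, s⟫ = 0 := by simp [s, inner_sum, he, (Fin.succ_ne_zero _).symm]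
  let x : Fin k → EuclideanSpace ℝ (Fin (k + 1)) := fun i => a • e i.succ + b • s
  refine ⟨e 0, x, (he 0 0).trans (if_pos rfl), fun i => ?_, fun i j => ?_, ?_⟩
  · simp [x, inner_add_right, inner_smul_right, h0s, he, (Fin.succ_ne_zero _).symm]
  · simp only [x, inner_add_right, inner_add_left, inner_smul_right, real_inner_smul_left, he,
      hes, hse, hss, Fin.succ_inj]
    split_ifs
    · linear_combination hb2 + ha2
    · linear_combination hb2
  · set W := Submodule.span ℝ (insert (e 0) (Set.range x))
    have hx : ∀ i, x i ∈ W := fun i => Submodule.subset_span (Or.inr ⟨i, rfl⟩)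
    have hpos : a + k * b ≠ 0 := by positivity
    have hs : s ∈ W := by
      have h : ∑ i, x i = (a + k * b) • s := by
        simp [x, Finset.sum_add_distrib, ← Finset.smul_sum, s, add_smul, mul_smul,
          Nat.cast_smul_eq_nsmul]
      rw [← Submodule.smul_mem_iff W hpos, ← h]
      exact Submodule.sum_mem _ fun i _ => hx i
    have hmem : ∀ i, e i ∈ W := by
      refine Fin.cases (Submodule.subset_span (Or.inl rfl)) fun i => ?_
      rw [← Submodule.smul_mem_iff W ha.ne', show a • e i.succ = x i - b • s by simp [x]]
      exact Submodule.sub_mem _ (hx i) (Submodule.smul_mem _ _ hs)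
    rw [eq_top_iff, ← (EuclideanSpace.basisFun (Fin (k + 1)) ℝ).toBasis.span_eq,
      Submodule.span_le]
    rintro _ ⟨i, rfl⟩
    simpa [e] using hmem i

/-- A finite family with pairwise positive integral distances bounded by `D`, containing `0` and
linearly spanning the space, gives an integral point set of diameter at most `D`. -/
theorem exists_integral_point_set_of_family {E ι : Type*} [NormedAddCommGroup E]
    [NormedSpace ℝ E] [Fintype ι] (f : ι → E) (D : ℕ) (i₀ : ι) (h0 : f i₀ = 0)
    (hspan : Submodule.span ℝ (Set.range f) = ⊤)
    (hf : ∀ p q, p ≠ q → ∃ z : ℤ, 0 < z ∧ z ≤ D ∧ dist (f p) (f q) = z) :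
    ∃ S : Finset E, S.card = Fintype.card ι ∧ affineSpan ℝ (S : Set E) = ⊤ ∧
      (∀ p ∈ S, ∀ q ∈ S, ∃ z : ℤ, dist p q = (z : ℝ)) ∧ Metric.diam (S : Set E) ≤ D := by
  classical
  have hinj : Function.Injective f := by
    intro p q hpq
    by_contra hne
    obtain ⟨z, hz, -, h⟩ := hf p q hne
    rw [hpq, dist_self] at h
    exact hz.ne (by exact_mod_cast h)
  have hdist : ∀ p q, ∃ z : ℤ, z ≤ D ∧ dist (f p) (f q) = z := by
    intro p q
    by_cases hpq : p = q
    · exact ⟨0, by positivity, by simp [hpq]⟩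
    · obtain ⟨z, -, h⟩ := hf p q hpq
      exact ⟨z, h⟩
  refine ⟨Finset.univ.image f, Finset.card_image_of_injective _ hinj, ?_, ?_, ?_⟩
  · have hins : insert 0 (Set.range f) = Set.range f := Set.insert_eq_of_mem ⟨i₀, h0⟩
    apply SetLike.coe_injective
    rw [Finset.coe_image, Finset.coe_univ, Set.image_univ, ← hins, affineSpan_insert_zero, hspan]
    simp
  · simp only [Finset.mem_image, Finset.mem_univ, true_and]
    rintro _ ⟨p, rfl⟩ _ ⟨q, rfl⟩
    obtain ⟨z, -, h⟩ := hdist p q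
    exact ⟨z, h⟩
  · refine Metric.diam_le_of_forall_dist_le (Nat.cast_nonneg D) ?_
    simp only [Finset.coe_image, Finset.coe_univ, Set.image_univ]
    rintro _ ⟨p, rfl⟩ _ ⟨q, rfl⟩
    obtain ⟨z, hz, h⟩ := hdist p q
    rw [h]
    exact_mod_cast hz

/-- The positions of the points on the axis: each of them completes `15` to a Pythagorean triple. -/
def axisPosition : Fin 7 → ℤ := ![0, 8, -8, 20, -20, 36, -36]

/-- The sign attached to a Boolean. -/
def boolSign (b : Bool) : ℤ := if b then 1 else -1

theorem axisPosition_sub {p q : Fin 7} (h : p ≠ q) :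
    0 < |axisPosition p - axisPosition q| ∧ |axisPosition p - axisPosition q| ≤ 72 := by
  revert p q
  decide

theorem axisPosition_sq_add (p : Fin 7) :
    ∃ z : ℤ, 0 < z ∧ z ≤ 72 ∧ axisPosition p ^ 2 + 225 = z ^ 2 := by
  fin_cases p
  · exact ⟨15, by decide⟩
  · exact ⟨17, by decide⟩
  · exact ⟨17, by decide⟩
  · exact ⟨25, by decide⟩
  · exact ⟨25, by decide⟩
  · exact ⟨39, by decide⟩
  · exact ⟨39, by decide⟩

/-- For every integer `m ≥ 2`, there exists an integral point set of `2 * m + 5` points in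
`ℝ^m` (pairwise integral distances, not contained in any affine hyperplane) whose
diameter is at most `158`; that is, `d(m, 2 * m + 5) ≤ 158`. -/
theorem d_bound_stmt_7 :
    ∀ m : ℕ, 2 ≤ m →
      ∃ S : Finset (EuclideanSpace ℝ (Fin m)),
        S.card = 2 * m + 5 ∧
        affineSpan ℝ (S : Set (EuclideanSpace ℝ (Fin m))) = ⊤ ∧
        (∀ p ∈ S, ∀ q ∈ S, ∃ z : ℤ, dist p q = (z : ℝ)) ∧
        Metric.diam (S : Set (EuclideanSpace ℝ (Fin m))) ≤ 158 := by
  intro m hm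
  obtain ⟨k, rfl⟩ : ∃ k, m = k + 1 := ⟨m - 1, by omega⟩
  obtain ⟨n, x, hn, hnx, hx, hspan⟩ := exists_spanning_equiangular k
  let f : Fin 7 ⊕ Fin k × Bool → EuclideanSpace ℝ (Fin (k + 1)) :=
    Sum.elim (fun p => (axisPosition p : ℝ) • n) (fun q => (boolSign q.2 : ℝ) • x q.1)
  have dist_eq : ∀ (v w : EuclideanSpace ℝ (Fin (k + 1))) (z : ℤ), 0 ≤ z →
      ⟪v, v⟫ - 2 * ⟪v, w⟫ + ⟪w, w⟫ = (z : ℝ) ^ 2 → dist v w = z := by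
    intro v w z hz h
    have hz' : (0 : ℝ) ≤ z := by exact_mod_cast hz
    rw [dist_eq_norm, ← sq_eq_sq₀ (norm_nonneg _) hz', ← real_inner_self_eq_norm_sq,
      real_inner_sub_sub_self, h]
  have hsign : ∀ b c, b = c → (boolSign b : ℝ) * boolSign c = 1 := by
    rintro (_ | _) _ rfl <;> norm_num [boolSign]
  have hsign' : ∀ b c, b ≠ c → (boolSign b : ℝ) * boolSign c = -1 := by
    rintro (_ | _) (_ | _) h <;> simp [boolSign] at h ⊢
  have axis_side : ∀ p q, ∃ z : ℤ, 0 < z ∧ z ≤ 72 ∧ dist (f (.inl p)) (f (.inr q)) = z := by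
    intro p ⟨i, b⟩
    obtain ⟨z, hz, hz', h⟩ := axisPosition_sq_add p
    refine ⟨z, hz, hz', dist_eq _ _ z hz.le ?_⟩
    have h' : (axisPosition p : ℝ) ^ 2 + 225 = (z : ℝ) ^ 2 := by exact_mod_cast h
    simp only [f, Sum.elim_inl, Sum.elim_inr, inner_smul_right, real_inner_smul_left, hn, hnx, hx,
      if_true]
    linear_combination h' + 225 * hsign b b rfl
  have hf : ∀ p q, p ≠ q → ∃ z : ℤ, 0 < z ∧ z ≤ (72 : ℕ) ∧ dist (f p) (f q) = z := by
    rintro (p | ⟨i, b⟩) (q | ⟨j, c⟩) hpq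
    · have hpq' : p ≠ q := fun h => hpq (by rw [h])
      refine ⟨_, (axisPosition_sub hpq').1, (axisPosition_sub hpq').2,
        dist_eq _ _ _ (abs_nonneg _) ?_⟩
      simp only [f, Sum.elim_inl, inner_smul_right, real_inner_smul_left, hn]
      push_cast
      rw [sq_abs]
      ring
    · exact axis_side p (j, c)
    · rw [dist_comm]
      exact axis_side q (i, b)
    · have hinner : ∀ z : ℤ, 0 ≤ z →
          450 - 2 * (boolSign b * boolSign c * if i = j then 225 else 63) = (z : ℝ) ^ 2 →
          dist (f (.inr (i, b))) (f (.inr (j, c))) = z := by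
        intro z hz h
        refine dist_eq _ _ z hz ?_
        simp only [f, Sum.elim_inr, inner_smul_right, real_inner_smul_left, hx, if_true]
        linear_combination h + 225 * hsign b b rfl + 225 * hsign c c rfl
      by_cases hbc : b = c
      · have hij : i ≠ j := fun h => hpq (by rw [h, hbc])
        refine ⟨18, by norm_num, by norm_num, hinner _ (by norm_num) ?_⟩
        norm_num [hsign b c hbc, hij]
      · by_cases hij : i = j
        · refine ⟨30, by norm_num, by norm_num, hinner _ (by norm_num) ?_⟩
          norm_num [hsign' b c hbc, hij]
        · refine ⟨24, by norm_num, by norm_num, hinner _ (by norm_num) ?_⟩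
          norm_num [hsign' b c hbc, hij]
  have hfspan : Submodule.span ℝ (Set.range f) = ⊤ := by
    rw [eq_top_iff, ← hspan, Submodule.span_le]
    rintro _ (rfl | ⟨i, rfl⟩)
    · have h : f (.inl 1) ∈ Submodule.span ℝ (Set.range f) := Submodule.subset_span ⟨_, rfl⟩
      exact (Submodule.smul_mem_iff _ (by norm_num [axisPosition])).1 h
    · exact Submodule.subset_span ⟨.inr (i, true), by simp [f, boolSign]⟩
  obtain ⟨S, hcard, haff, hint, hdiam⟩ := exists_integral_point_set_of_family f 72 (.inl 0)
    (by simp [f, axisPosition]) hfspan hf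
  refine ⟨S, ?_, haff, hint, hdiam.trans (by norm_num)⟩
  rw [hcard]
  simp
  ring
end

section
/- For every integer m ≥ 2, d(m, 2m + 7) ≤ 252; that is, there exists an integral point set of 2m + 7 points in m-dimensional Euclidean space ℝ^m whose diameter is at most 252. -/
/-- The point of `ℝ^(N+1)` with first coordinate `t` and remaining coordinates `v`. -/
noncomputable def consPoint {N : ℕ} (t : ℝ) (v : Fin N → ℝ) : EuclideanSpace ℝ (Fin (N + 1)) :=
  WithLp.toLp 2 (Fin.cons t v)

theorem dist_consPoint_sq {N : ℕ} (s t : ℝ) (v w : Fin N → ℝ) :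
    dist (consPoint s v) (consPoint t w) ^ 2 = (s - t) ^ 2 + ∑ j, (v j - w j) ^ 2 := by
  rw [EuclideanSpace.dist_eq, Real.sq_sqrt (Finset.sum_nonneg fun _ _ => sq_nonneg _)]
  simp [consPoint, Fin.sum_univ_succ, Real.dist_eq, sq_abs]

theorem inner_consPoint {N : ℕ} (s : ℝ) (v : Fin N → ℝ) (z : EuclideanSpace ℝ (Fin (N + 1))) :
    inner ℝ (consPoint s v) z = s * z 0 + ∑ j, v j * z j.succ := by
  simp [consPoint, PiLp.inner_apply, Fin.sum_univ_succ, mul_comm]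

/-- Vertices of a regular simplex of edge length `√2 * α`, symmetric under permuting coordinates. -/
noncomputable def simplexVertex {N : ℕ} (α β : ℝ) (i : Fin N) : Fin N → ℝ :=
  fun j => β + if j = i then α else 0

theorem sum_simplexVertex_mul {N : ℕ} (α β : ℝ) (i : Fin N) (z : Fin N → ℝ) :
    ∑ j, simplexVertex α β i j * z j = β * ∑ j, z j + α * z i := by
  simp [simplexVertex, add_mul, Finset.sum_add_distrib, Finset.mul_sum]

theorem sum_simplexVertex_sq {N : ℕ} (α β : ℝ) (i : Fin N) :
    ∑ j, simplexVertex α β i j ^ 2 = N * β ^ 2 + 2 * α * β + α ^ 2 := by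
  have h := sum_simplexVertex_mul α β i (simplexVertex α β i)
  simp only [← sq] at h
  rw [h]
  simp [simplexVertex, Finset.sum_add_distrib]
  ring

theorem sum_simplexVertex_sub_sq {N : ℕ} (α β : ℝ) {i k : Fin N} (hik : i ≠ k) :
    ∑ j, (simplexVertex α β i j - simplexVertex α β k j) ^ 2 = 2 * α ^ 2 := by
  have h : ∀ j, (simplexVertex α β i j - simplexVertex α β k j) ^ 2 =
      (if j = i then α ^ 2 else 0) + if j = k then α ^ 2 else 0 := by
    intro j
    by_cases hi : j = i
    · subst hi
      simp [simplexVertex, hik]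
    · by_cases hk : j = k <;> simp [simplexVertex, hi, hk, hik.symm]
  simp [h, Finset.sum_add_distrib]
  ring

/-- Positions on the line `ℝ × {0}`. -/
def linePos : Fin 9 → ℤ := ![-99, -54, -23, 18, 37, 62, 81, 122, 153]

/-- Heights of the two parallel simplices. -/
def simplexHeight (b : Bool) : ℤ := if b then 99 else 0

/-- Distances from the points on the line to the vertices of the two simplices. -/
def lineSimplexDist (k : Fin 9) (b : Bool) : ℕ :=
  if b then ![222, 183, 158, 129, 118, 107, 102, 103, 114] k
  else ![141, 114, 103, 102, 107, 118, 129, 158, 183] k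

theorem lineSimplexDist_spec (k : Fin 9) (b : Bool) :
    (linePos k - simplexHeight b) ^ 2 + 10080 = (lineSimplexDist k b : ℤ) ^ 2 ∧
      lineSimplexDist k b ≤ 252 ∧ lineSimplexDist k b ≠ 0 := by
  revert k b
  decide

theorem linePos_sub_spec (k l : Fin 9) :
    (linePos k - linePos l).natAbs ≤ 252 ∧ (k ≠ l → (linePos k - linePos l).natAbs ≠ 0) := by
  revert k l
  decide

/-- Nine collinear points together with the vertices of two parallel regular simplices. -/
noncomputable def lineSimplexPoint {N : ℕ} (α β : ℝ) :
    Fin 9 ⊕ (Fin N × Bool) → EuclideanSpace ℝ (Fin (N + 1))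
  | .inl k => consPoint (linePos k) 0
  | .inr (i, b) => consPoint (simplexHeight b) (simplexVertex α β i)

theorem dist_lineSimplexPoint {N : ℕ} {α β : ℝ} (hα : α ^ 2 = 200)
    (hβ : N * β ^ 2 + 2 * α * β + α ^ 2 = 10080) (p q : Fin 9 ⊕ (Fin N × Bool)) :
    ∃ n : ℕ, dist (lineSimplexPoint α β p) (lineSimplexPoint α β q) = n ∧ n ≤ 252 ∧
      (p ≠ q → n ≠ 0) := by
  suffices h : ∃ n : ℕ, dist (lineSimplexPoint α β p) (lineSimplexPoint α β q) ^ 2 = (n : ℝ) ^ 2 ∧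
      n ≤ 252 ∧ (p ≠ q → n ≠ 0) by
    obtain ⟨n, hn, h⟩ := h
    exact ⟨n, (sq_eq_sq₀ dist_nonneg n.cast_nonneg).1 hn, h⟩
  have cross (k : Fin 9) (i : Fin N) (b : Bool) :
      dist (lineSimplexPoint α β (.inl k)) (lineSimplexPoint α β (.inr (i, b))) ^ 2 =
        (lineSimplexDist k b : ℝ) ^ 2 := by
    simp only [lineSimplexPoint, dist_consPoint_sq, Pi.zero_apply, zero_sub, neg_sq,
      sum_simplexVertex_sq, hβ]
    exact_mod_cast (lineSimplexDist_spec k b).1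
  rcases p with k | ⟨i, b⟩ <;> rcases q with l | ⟨j, c⟩
  · refine ⟨(linePos k - linePos l).natAbs, ?_, (linePos_sub_spec k l).1, fun h =>
      (linePos_sub_spec k l).2 (by simpa using h)⟩
    simp only [lineSimplexPoint, dist_consPoint_sq, Nat.cast_natAbs]
    simp
  · exact ⟨_, cross k j c, (lineSimplexDist_spec k c).2.1, fun _ => (lineSimplexDist_spec k c).2.2⟩
  · rw [dist_comm]
    exact ⟨_, cross l i b, (lineSimplexDist_spec l b).2.1, fun _ => (lineSimplexDist_spec l b).2.2⟩
  · simp only [lineSimplexPoint, dist_consPoint_sq]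
    by_cases hij : i = j
    · subst hij
      by_cases hbc : b = c
      · exact ⟨0, by simp [hbc], by norm_num, by simp [hbc]⟩
      · refine ⟨99, ?_, by norm_num, by norm_num⟩
        cases b <;> cases c <;> simp_all [simplexHeight]
    · rw [sum_simplexVertex_sub_sq α β hij, hα]
      by_cases hbc : b = c
      · exact ⟨20, by simp [hbc]; norm_num, by norm_num, by norm_num⟩
      · refine ⟨101, ?_, by norm_num, by norm_num⟩
        cases b <;> cases c <;> simp_all [simplexHeight] <;> norm_num

theorem affineSpan_range_lineSimplexPoint {N : ℕ} {α β : ℝ} (hα : 0 < α) (hβ : 0 ≤ β) :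
    affineSpan ℝ (Set.range (lineSimplexPoint (N := N) α β)) = ⊤ := by
  have hne : (Set.range (lineSimplexPoint (N := N) α β)).Nonempty := ⟨_, .inl 0, rfl⟩
  rw [← AffineSubspace.direction_eq_top_iff_of_nonempty ((affineSpan_nonempty ℝ).2 hne),
    direction_affineSpan, ← Submodule.orthogonal_eq_bot_iff, Submodule.eq_bot_iff]
  intro z hz
  have hconst (p q : Fin 9 ⊕ (Fin N × Bool)) :
      inner ℝ (lineSimplexPoint α β p) z = inner ℝ (lineSimplexPoint α β q) z := by
    rw [← sub_eq_zero, ← inner_sub_left]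
    exact (Submodule.mem_orthogonal _ z).1 hz _ (vsub_mem_vectorSpan ℝ ⟨p, rfl⟩ ⟨q, rfl⟩)
  have hzero : z 0 = 0 := by
    have h := hconst (.inl 0) (.inl 1)
    simp [lineSimplexPoint, inner_consPoint, linePos] at h
    linarith
  have hvertex (i : Fin N) : β * ∑ j, z (Fin.succ j) + α * z i.succ = 0 := by
    have h := hconst (.inr (i, false)) (.inl 0)
    simpa [lineSimplexPoint, inner_consPoint, hzero,
      sum_simplexVertex_mul α β i fun j => z (Fin.succ j)] using h
  have hsum : ∑ j, z (Fin.succ j) = 0 := by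
    have h := Finset.sum_eq_zero fun i (_ : i ∈ Finset.univ) => hvertex i
    rw [Finset.sum_add_distrib, ← Finset.mul_sum _ _ α, Finset.sum_const, Finset.card_univ,
      Fintype.card_fin, nsmul_eq_mul, ← mul_assoc, ← add_mul] at h
    exact (mul_eq_zero.1 h).resolve_left (by positivity)
  ext i
  refine Fin.cases hzero (fun i => ?_) i
  simpa [hsum, hα.ne'] using hvertex i

/-- For every integer `m ≥ 2`, there exists an integral point set of `2 * m + 7` points in
`ℝ^m` (pairwise integral distances, not contained in any affine hyperplane) whose
diameter is at most `252`; that is, `d(m, 2 * m + 7) ≤ 252`. -/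
theorem d_bound_stmt_9 :
    ∀ m : ℕ, 2 ≤ m →
      ∃ S : Finset (EuclideanSpace ℝ (Fin m)),
        S.card = 2 * m + 7 ∧
        affineSpan ℝ (S : Set (EuclideanSpace ℝ (Fin m))) = ⊤ ∧
        (∀ p ∈ S, ∀ q ∈ S, ∃ z : ℤ, dist p q = (z : ℝ)) ∧
        Metric.diam (S : Set (EuclideanSpace ℝ (Fin m))) ≤ 252 := by
  intro m hm
  obtain ⟨N, rfl⟩ : ∃ N, m = N + 1 := ⟨m - 1, by omega⟩
  have hN : (0 : ℝ) < N := by exact_mod_cast (by omega : 0 < N)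
  obtain ⟨α, hα, hα2⟩ : ∃ α : ℝ, 0 < α ∧ α ^ 2 = 200 :=
    ⟨√200, by positivity, Real.sq_sqrt (by norm_num)⟩
  obtain ⟨β, hβ, hβ2⟩ : ∃ β : ℝ, 0 ≤ β ∧ N * β ^ 2 + 2 * α * β + α ^ 2 = 10080 := by
    obtain ⟨s, hαs, hs⟩ : ∃ s : ℝ, α ≤ s ∧ s ^ 2 = α ^ 2 + 9880 * N :=
      ⟨√(α ^ 2 + 9880 * N), Real.le_sqrt_of_sq_le (by linarith), Real.sq_sqrt (by positivity)⟩
    refine ⟨(s - α) / N, div_nonneg (sub_nonneg.2 hαs) hN.le, ?_⟩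
    field_simp
    linear_combination hs + N * hα2
  have hdist := dist_lineSimplexPoint hα2 hβ2
  have hinj : Function.Injective (lineSimplexPoint (N := N) α β) := by
    intro p q hpq
    by_contra hne
    obtain ⟨n, hn, -, hn0⟩ := hdist p q
    rw [hpq, dist_self] at hn
    exact hn0 hne (by exact_mod_cast hn.symm)
  refine ⟨Finset.univ.map ⟨_, hinj⟩, ?_, ?_, ?_, ?_⟩
  · simp
    ring
  · simpa using affineSpan_range_lineSimplexPoint hα hβ
  · simp only [Finset.mem_map, Finset.mem_univ, true_and, Function.Embedding.coeFn_mk]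
    rintro _ ⟨p, rfl⟩ _ ⟨q, rfl⟩
    obtain ⟨n, hn, -⟩ := hdist p q
    exact ⟨n, by simpa using hn⟩
  · refine Metric.diam_le_of_forall_dist_le (by norm_num) ?_
    simp only [Finset.coe_map, Finset.coe_univ, Set.image_univ, Function.Embedding.coeFn_mk]
    rintro _ ⟨p, rfl⟩ _ ⟨q, rfl⟩
    obtain ⟨n, hn, hle, -⟩ := hdist p q
    rw [hn]
    exact_mod_cast hle
end

section
/- For every integer m ≥ 2, d(m, 2m + 12) ≤ 2189; that is, there exists an integral point set of 2m + 12 points in m-dimensional Euclidean space ℝ^m whose diameter is at most 2189. -/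
/-- The point at height `h` on the axis (the zeroth coordinate), displaced by `√2 * s` in the
direction of the `i`-th coordinate orthogonal to the axis. -/
noncomputable def displacedPoint {k : ℕ} (h s : ℤ) (i : Fin k) : EuclideanSpace ℝ (Fin (k + 1)) :=
  EuclideanSpace.single 0 (h : ℝ) + EuclideanSpace.single i.succ (√2 * s)

/-- The squared distance of `displacedPoint h s i` and `displacedPoint g t j`. -/
def displacedSqDist {k : ℕ} (h s : ℤ) (i : Fin k) (g t : ℤ) (j : Fin k) : ℤ :=
  (h - g) ^ 2 + if i = j then 2 * (s - t) ^ 2 else 2 * (s ^ 2 + t ^ 2)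

theorem dist_displacedPoint_sq {k : ℕ} (h s : ℤ) (i : Fin k) (g t : ℤ) (j : Fin k) :
    dist (displacedPoint h s i) (displacedPoint g t j) ^ 2 = displacedSqDist h s i g t j := by
  have h2 : (√2 : ℝ) ^ 2 = 2 := Real.sq_sqrt (by norm_num)
  rw [EuclideanSpace.dist_eq, Real.sq_sqrt (by positivity), Fin.sum_univ_succ]
  simp only [displacedPoint, displacedSqDist, Real.dist_eq, sq_abs, PiLp.add_apply,
    PiLp.single_apply, Fin.succ_ne_zero, (Fin.succ_ne_zero _).symm, if_true, if_false,
    Fin.succ_inj, add_zero, zero_add]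
  split_ifs with hij
  · subst hij
    have : ∀ x : Fin k, ((if x = i then √2 * (s : ℝ) else 0) - if x = i then √2 * (t : ℝ) else 0) ^ 2
        = if x = i then 2 * ((s : ℝ) - t) ^ 2 else 0 := by
      intro x
      split_ifs
      · linear_combination ((s : ℝ) - t) ^ 2 * h2
      · ring
    simp [this]
  · have : ∀ x : Fin k, ((if x = i then √2 * (s : ℝ) else 0) - if x = j then √2 * (t : ℝ) else 0) ^ 2
        = (if x = i then 2 * (s : ℝ) ^ 2 else 0) + if x = j then 2 * (t : ℝ) ^ 2 else 0 := by
      intro x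
      split_ifs with h₁ h₃
      · exact absurd (h₁.symm.trans h₃) hij
      · linear_combination (s : ℝ) ^ 2 * h2
      · linear_combination (t : ℝ) ^ 2 * h2
      · ring
    simp [this, Finset.sum_add_distrib]
    ring

theorem dist_displacedPoint_of_sq {k : ℕ} {h s g t : ℤ} {i j : Fin k} {z : ℤ} (hz : 0 ≤ z)
    (hd : displacedSqDist h s i g t j = z ^ 2) :
    dist (displacedPoint h s i) (displacedPoint g t j) = z := by
  have := dist_displacedPoint_sq h s i g t j
  rw [hd, Int.cast_pow] at this
  exact (pow_left_inj₀ dist_nonneg (by exact_mod_cast hz) two_ne_zero).1 this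

theorem submodule_eq_top_of_displaced {k : ℕ} {U : Submodule ℝ (EuclideanSpace ℝ (Fin (k + 1)))}
    {h : ℝ} (hh : h ≠ 0) (hw : EuclideanSpace.single 0 h ∈ U)
    (he : ∀ i : Fin k, ∃ c d : ℝ, d ≠ 0 ∧
      EuclideanSpace.single 0 c + EuclideanSpace.single i.succ d ∈ U) : U = ⊤ := by
  have hsingle : ∀ (i : Fin (k + 1)) (c d : ℝ), d ≠ 0 → EuclideanSpace.single i d ∈ U →
      EuclideanSpace.single i c ∈ U := by
    intro i c d hd hi
    convert U.smul_mem (c / d) hi using 1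
    ext x
    simp [PiLp.single_apply, hd]
  rw [eq_top_iff, ← (EuclideanSpace.basisFun (Fin (k + 1)) ℝ).toBasis.span_eq, Submodule.span_le]
  rintro _ ⟨i, rfl⟩
  refine Fin.cases ?_ (fun i => ?_) i
  · simpa using hsingle 0 1 h hh hw
  · obtain ⟨c, d, hd, hi⟩ := he i
    simpa using hsingle i.succ 1 d hd ((U.add_mem_iff_right (hsingle 0 c h hh hw)).1 hi)

/-- An injectively indexed family with bounded integral distances yields an integral point set. -/
theorem exists_integral_finset {m n : ℕ} {ι : Type*} [Fintype ι] [Nonempty ι]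
    (f : ι → EuclideanSpace ℝ (Fin m)) (hcard : Fintype.card ι = n)
    (hdist : ∀ a b, a ≠ b → ∃ z : ℤ, 0 < z ∧ z ≤ 2189 ∧ dist (f a) (f b) = z)
    (hspan : vectorSpan ℝ (Set.range f) = ⊤) :
    ∃ S : Finset (EuclideanSpace ℝ (Fin m)),
        S.card = n ∧
        affineSpan ℝ (S : Set (EuclideanSpace ℝ (Fin m))) = ⊤ ∧
        (∀ p ∈ S, ∀ q ∈ S, ∃ z : ℤ, dist p q = (z : ℝ)) ∧
        Metric.diam (S : Set (EuclideanSpace ℝ (Fin m))) ≤ 2189 := by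
  classical
  have hinj : Function.Injective f := by
    intro a b hab
    by_contra hne
    obtain ⟨z, hz, -, h⟩ := hdist a b hne
    rw [hab, dist_self] at h
    exact hz.ne (by exact_mod_cast h)
  have hall : ∀ a b, ∃ z : ℤ, z ≤ 2189 ∧ dist (f a) (f b) = z := by
    intro a b
    rcases eq_or_ne a b with rfl | hne
    · exact ⟨0, by norm_num, by simp⟩
    · obtain ⟨z, -, hz⟩ := hdist a b hne
      exact ⟨z, hz⟩
  refine ⟨Finset.univ.image f, ?_, ?_, ?_, ?_⟩
  · rw [Finset.card_image_of_injective _ hinj, Finset.card_univ, hcard]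
  · rw [Finset.coe_image, Finset.coe_univ, Set.image_univ,
      AffineSubspace.affineSpan_eq_top_iff_vectorSpan_eq_top_of_nonempty _ _ _
        (Set.range_nonempty f)]
    exact hspan
  · simp only [Finset.mem_image, Finset.mem_univ, true_and]
    rintro _ ⟨a, rfl⟩ _ ⟨b, rfl⟩
    obtain ⟨z, -, hz⟩ := hall a b
    exact ⟨z, hz⟩
  · refine Metric.diam_le_of_forall_dist_le (by norm_num) ?_
    simp only [Finset.coe_image, Finset.coe_univ, Set.image_univ]
    rintro _ ⟨a, rfl⟩ _ ⟨b, rfl⟩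
    obtain ⟨z, hz, h⟩ := hall a b
    rw [h]
    exact_mod_cast hz

/-- Heights `t` for which `t ^ 2 + 2 * 60 ^ 2` is a perfect square. -/
def axisHeight : Fin 27 → ℤ :=
  ![-5, 5, -14, 14, -30, 30, -47, 47, -51, 51, -70, 70, -82, 82, -105, 105, -138, 138, -170, 170,
    -191, 191, -217, 217, -294, 294, -355]

theorem axisHeight_injective : Function.Injective axisHeight := by decide

theorem abs_axisHeight_le (a : Fin 27) : |axisHeight a| ≤ 355 := by
  revert a
  decide

/-- The distance of the axis point at height `axisHeight a` from the points at height `0` with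
displacement `60 * √2`. -/
def axisDist : Fin 27 → ℤ :=
  ![85, 85, 86, 86, 90, 90, 97, 97, 99, 99, 110, 110, 118, 118, 135, 135, 162, 162, 190, 190,
    209, 209, 233, 233, 306, 306, 365]

theorem axisDist_pos (a : Fin 27) : 0 < axisDist a := by
  revert a
  decide

theorem axisDist_le (a : Fin 27) : axisDist a ≤ 365 := by
  revert a
  decide

theorem axisHeight_sq_add (a : Fin 27) : axisHeight a ^ 2 + 7200 = axisDist a ^ 2 := by
  revert a
  decide

/-- In low dimensions: many points on an axis together with a regular simplex of edge length `120`
in a hyperplane orthogonal to it. -/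
noncomputable def axisConfiguration {k : ℕ} [NeZero k] (hk : k ≤ 13) :
    Fin (k + 14) ⊕ Fin k → EuclideanSpace ℝ (Fin (k + 1)) :=
  Sum.elim (fun a => displacedPoint (axisHeight (a.castLE (by omega))) 0 0)
    (fun i => displacedPoint 0 60 i)

theorem dist_axisConfiguration {k : ℕ} [NeZero k] (hk : k ≤ 13) (a b : Fin (k + 14) ⊕ Fin k)
    (hab : a ≠ b) : ∃ z : ℤ, 0 < z ∧ z ≤ 2189 ∧
      dist (axisConfiguration hk a) (axisConfiguration hk b) = z := by
  have key : ∀ (a : Fin (k + 14)) (i : Fin k), ∃ z : ℤ, 0 < z ∧ z ≤ 2189 ∧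
      dist (axisConfiguration hk (.inl a)) (axisConfiguration hk (.inr i)) = z := by
    intro a i
    refine ⟨axisDist (a.castLE (by omega)), axisDist_pos _, (axisDist_le _).trans (by norm_num),
      dist_displacedPoint_of_sq (axisDist_pos _).le ?_⟩
    rw [← axisHeight_sq_add, displacedSqDist]
    split_ifs <;> ring
  rcases a with a | i <;> rcases b with b | j
  · have hne : axisHeight (a.castLE (by omega)) ≠ axisHeight (b.castLE (by omega)) := by
      intro h
      exact hab (congrArg _ (Fin.castLE_injective _ (axisHeight_injective h)))
    refine ⟨_, abs_pos.2 (sub_ne_zero.2 hne), ?_,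
      dist_displacedPoint_of_sq (abs_nonneg _) (by simp [displacedSqDist])⟩
    refine (abs_sub _ _).trans ((add_le_add (abs_axisHeight_le _) (abs_axisHeight_le _)).trans ?_)
    norm_num
  · exact key a j
  · rw [dist_comm]
    exact key b i
  · have hij : i ≠ j := fun h => hab (congrArg _ h)
    exact ⟨120, by norm_num, by norm_num,
      dist_displacedPoint_of_sq (by norm_num) (by simp [displacedSqDist, hij])⟩

theorem vectorSpan_axisConfiguration {k : ℕ} [NeZero k] (hk : k ≤ 13) :
    vectorSpan ℝ (Set.range (axisConfiguration hk)) = ⊤ := by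
  have hmem : ∀ a b, axisConfiguration hk a - axisConfiguration hk b ∈
      vectorSpan ℝ (Set.range (axisConfiguration hk)) := fun a b =>
    vsub_mem_vectorSpan ℝ (Set.mem_range_self a) (Set.mem_range_self b)
  have h₀ : axisConfiguration hk (.inl ⟨0, by omega⟩) = displacedPoint (-5) 0 0 := rfl
  have h₁ : axisConfiguration hk (.inl ⟨1, by omega⟩) = displacedPoint 5 0 0 := rfl
  have hr : ∀ i, axisConfiguration hk (.inr i) = displacedPoint 0 60 i := fun _ => rfl
  refine submodule_eq_top_of_displaced (h := 10) (by norm_num) ?_ fun i => ⟨5, √2 * 60, ?_, ?_⟩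
  · convert hmem (.inl ⟨1, by omega⟩) (.inl ⟨0, by omega⟩) using 1
    ext x
    simp only [h₁, h₀, displacedPoint, PiLp.single_apply, PiLp.add_apply, PiLp.sub_apply]
    split_ifs <;> norm_num
  · positivity
  · convert hmem (.inr i) (.inl ⟨0, by omega⟩) using 1
    ext x
    simp only [hr, h₀, displacedPoint, PiLp.single_apply, PiLp.add_apply, PiLp.sub_apply]
    split_ifs <;> simp <;> ring

/-- In high dimensions: two parallel copies of a regular simplex of edge length `8` at distance `6`,
and part of an oppositely oriented simplex of edge length `4` halfway between them. -/
noncomputable def layerConfiguration {k : ℕ} (hk : 14 ≤ k) :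
    Fin k ⊕ Fin k ⊕ Fin 14 → EuclideanSpace ℝ (Fin (k + 1)) :=
  Sum.elim (fun i => displacedPoint 0 4 i)
    (Sum.elim (fun i => displacedPoint 6 4 i) (fun i => displacedPoint 3 (-2) (i.castLE hk)))

theorem dist_layerConfiguration {k : ℕ} (hk : 14 ≤ k) (a b : Fin k ⊕ Fin k ⊕ Fin 14)
    (hab : a ≠ b) : ∃ z : ℤ, 0 < z ∧ z ≤ 2189 ∧
      dist (layerConfiguration hk a) (layerConfiguration hk b) = z := by
  have of_sq : ∀ {h s g t : ℤ} {i j : Fin k} (z : ℤ), 0 < z → z ≤ 2189 →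
      displacedSqDist h s i g t j = z ^ 2 → ∃ z : ℤ, 0 < z ∧ z ≤ 2189 ∧
        dist (displacedPoint h s i) (displacedPoint g t j) = z :=
    fun z hz hz' hd => ⟨z, hz, hz', dist_displacedPoint_of_sq hz.le hd⟩
  have outer : ∀ i j : Fin k, ∃ z : ℤ, 0 < z ∧ z ≤ 2189 ∧
      dist (displacedPoint 0 4 i) (displacedPoint 6 4 j) = z := by
    intro i j
    by_cases hij : i = j
    · exact of_sq 6 (by norm_num) (by norm_num) (by simp [displacedSqDist, hij])
    · exact of_sq 10 (by norm_num) (by norm_num) (by simp [displacedSqDist, hij])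
  have lower : ∀ i j : Fin k, ∃ z : ℤ, 0 < z ∧ z ≤ 2189 ∧
      dist (displacedPoint 0 4 i) (displacedPoint 3 (-2) j) = z := by
    intro i j
    by_cases hij : i = j
    · exact of_sq 9 (by norm_num) (by norm_num) (by simp [displacedSqDist, hij])
    · exact of_sq 7 (by norm_num) (by norm_num) (by simp [displacedSqDist, hij])
  have upper : ∀ i j : Fin k, ∃ z : ℤ, 0 < z ∧ z ≤ 2189 ∧
      dist (displacedPoint 6 4 i) (displacedPoint 3 (-2) j) = z := by
    intro i j
    by_cases hij : i = j
    · exact of_sq 9 (by norm_num) (by norm_num) (by simp [displacedSqDist, hij])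
    · exact of_sq 7 (by norm_num) (by norm_num) (by simp [displacedSqDist, hij])
  rcases a with i | i | i <;> rcases b with j | j | j
  · have hij : i ≠ j := fun h => hab (congrArg _ h)
    exact of_sq 8 (by norm_num) (by norm_num) (by simp [displacedSqDist, hij])
  · exact outer i j
  · exact lower i _
  · rw [dist_comm]
    exact outer j i
  · have hij : i ≠ j := fun h => hab (congrArg _ (congrArg _ h))
    exact of_sq 8 (by norm_num) (by norm_num) (by simp [displacedSqDist, hij])
  · exact upper i _
  · rw [dist_comm]
    exact lower j _
  · rw [dist_comm]
    exact upper j _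
  · have hij : i ≠ j := fun h => hab (congrArg _ (congrArg _ h))
    exact of_sq 4 (by norm_num) (by norm_num) (by simp [displacedSqDist, hij])

theorem vectorSpan_layerConfiguration {k : ℕ} (hk : 14 ≤ k) :
    vectorSpan ℝ (Set.range (layerConfiguration hk)) = ⊤ := by
  have hmem : ∀ a b, layerConfiguration hk a - layerConfiguration hk b ∈
      vectorSpan ℝ (Set.range (layerConfiguration hk)) := fun a b =>
    vsub_mem_vectorSpan ℝ (Set.mem_range_self a) (Set.mem_range_self b)
  let o : Fin k := (0 : Fin 14).castLE hk
  refine submodule_eq_top_of_displaced (h := 6) (by norm_num) ?_ fun i => ⟨-2, √2 * 4, ?_, ?_⟩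
  · convert hmem (.inr (.inl o)) (.inl o) using 1
    ext x
    simp [layerConfiguration, displacedPoint, PiLp.single_apply]
  · positivity
  · convert Submodule.add_mem _ (hmem (.inl i) (.inl o))
      (Submodule.smul_mem _ (2 / 3 : ℝ) (hmem (.inl o) (.inr (.inr 0)))) using 1
    ext x
    simp [layerConfiguration, displacedPoint, PiLp.single_apply, o]
    split_ifs <;> ring

/-- For every integer `m ≥ 2`, there exists an integral point set of `2 * m + 12` points in
`ℝ^m` (pairwise integral distances, not contained in any affine hyperplane) whose
diameter is at most `2189`; that is, `d(m, 2 * m + 12) ≤ 2189`. -/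
theorem d_bound_stmt_14 :
    ∀ m : ℕ, 2 ≤ m →
      ∃ S : Finset (EuclideanSpace ℝ (Fin m)),
        S.card = 2 * m + 12 ∧
        affineSpan ℝ (S : Set (EuclideanSpace ℝ (Fin m))) = ⊤ ∧
        (∀ p ∈ S, ∀ q ∈ S, ∃ z : ℤ, dist p q = (z : ℝ)) ∧
        Metric.diam (S : Set (EuclideanSpace ℝ (Fin m))) ≤ 2189 := by
  intro m hm
  obtain ⟨k, rfl⟩ : ∃ k, m = k + 1 := ⟨m - 1, by omega⟩
  have : NeZero k := ⟨by omega⟩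
  rcases Nat.lt_or_ge k 14 with hk | hk
  · exact exists_integral_finset (axisConfiguration (Nat.le_of_lt_succ hk))
      (by simp only [Fintype.card_sum, Fintype.card_fin]; omega)
      (dist_axisConfiguration _) (vectorSpan_axisConfiguration _)
  · exact exists_integral_finset (layerConfiguration hk)
      (by simp only [Fintype.card_sum, Fintype.card_fin]; omega)
      (dist_layerConfiguration hk) (vectorSpan_layerConfiguration hk)
end

section
/- For every integer m ≥ 2, d(m, 2m + 14) ≤ 3696; that is, there exists an integral point set of 2m + 14 points in m-dimensional Euclidean space ℝ^m whose diameter is at most 3696. -/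
namespace IntegralPointSet

/-- The point with first coordinate `x` and all other coordinates equal to `s`. -/
noncomputable def axisPoint (k : ℕ) (s x : ℝ) : EuclideanSpace ℝ (Fin (k + 1)) :=
  WithLp.toLp 2 (Fin.cons x fun _ => s)

/-- The vertex `t • e_i` of a regular simplex, lifted to height `y` in the first coordinate. -/
noncomputable def prismPoint {k : ℕ} (t y : ℝ) (i : Fin k) : EuclideanSpace ℝ (Fin (k + 1)) :=
  WithLp.toLp 2 (Fin.cons y (Pi.single i t))

lemma dist_sq_eq_succ {k : ℕ} (p q : EuclideanSpace ℝ (Fin (k + 1))) :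
    dist p q ^ 2 = (p 0 - q 0) ^ 2 + ∑ i : Fin k, (p i.succ - q i.succ) ^ 2 := by
  rw [EuclideanSpace.dist_eq, Real.sq_sqrt (by positivity), Fin.sum_univ_succ]
  simp [Real.dist_eq, sq_abs]

lemma dist_sq_axisPoint (k : ℕ) (s x y : ℝ) :
    dist (axisPoint k s x) (axisPoint k s y) ^ 2 = (x - y) ^ 2 := by
  simp [dist_sq_eq_succ, axisPoint]

lemma dist_sq_axisPoint_prismPoint {k : ℕ} (s t x y : ℝ) (i : Fin k) :
    dist (axisPoint k s x) (prismPoint t y i) ^ 2 =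
      (x - y) ^ 2 + (k * s ^ 2 - 2 * t * s + t ^ 2) := by
  have h : ∀ j : Fin k, (s - (Pi.single i t : Fin k → ℝ) j) ^ 2 =
      s ^ 2 + (Pi.single i (t ^ 2 - 2 * t * s) : Fin k → ℝ) j := by
    intro j
    rcases eq_or_ne j i with rfl | hj
    · simp
      ring
    · simp [hj]
  simp only [dist_sq_eq_succ, axisPoint, prismPoint, Fin.cons_zero, Fin.cons_succ, h,
    Finset.sum_add_distrib, Finset.sum_pi_single', Finset.sum_const, Finset.card_univ,
    Fintype.card_fin, nsmul_eq_mul, Finset.mem_univ, if_true]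
  ring

lemma dist_sq_prismPoint_self {k : ℕ} (t x y : ℝ) (i : Fin k) :
    dist (prismPoint t x i) (prismPoint t y i) ^ 2 = (x - y) ^ 2 := by
  simp [dist_sq_eq_succ, prismPoint]

lemma dist_sq_prismPoint_of_ne {k : ℕ} (t x y : ℝ) {i j : Fin k} (hij : i ≠ j) :
    dist (prismPoint t x i) (prismPoint t y j) ^ 2 = (x - y) ^ 2 + 2 * t ^ 2 := by
  have h : ∀ l : Fin k, ((Pi.single i t : Fin k → ℝ) l - (Pi.single j t : Fin k → ℝ) l) ^ 2 =
      (Pi.single i (t ^ 2) : Fin k → ℝ) l + (Pi.single j (t ^ 2) : Fin k → ℝ) l := by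
    intro l
    rcases eq_or_ne l i with rfl | hi
    · simp [hij]
    · rcases eq_or_ne l j with rfl | hj
      · simp [hi]
      · simp [hi, hj]
  simp only [dist_sq_eq_succ, prismPoint, Fin.cons_zero, Fin.cons_succ, h,
    Finset.sum_add_distrib, Finset.sum_pi_single', Finset.mem_univ, if_true]
  ring

/-- Two points of the axis together with the base of the prism span the whole space, unless the
axis meets the hyperplane of the base. -/
lemma affineSpan_eq_top {k : ℕ} {s t x x' y : ℝ} (hx : x ≠ x') (ht : t ≠ 0) (hs : t - k * s ≠ 0)
    {S : Set (EuclideanSpace ℝ (Fin (k + 1)))} (h : axisPoint k s x ∈ S)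
    (h' : axisPoint k s x' ∈ S) (hy : ∀ i : Fin k, prismPoint t y i ∈ S) :
    affineSpan ℝ S = ⊤ := by
  rw [AffineSubspace.affineSpan_eq_top_iff_vectorSpan_eq_top_of_nonempty ℝ _ _ ⟨_, h⟩,
    eq_top_iff, ← (EuclideanSpace.basisFun (Fin (k + 1)) ℝ).toBasis.span_eq,
    Submodule.span_le]
  set V := vectorSpan ℝ S
  have e0 : EuclideanSpace.single (0 : Fin (k + 1)) (1 : ℝ) ∈ V := by
    have := V.smul_mem (x - x')⁻¹ (vsub_mem_vectorSpan ℝ h h')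
    convert this using 1
    ext j
    refine Fin.cases ?_ (fun j => ?_) j
    · simp [axisPoint, sub_ne_zero.2 hx]
    · simp [axisPoint]
  have ed : ∀ i : Fin k, t • EuclideanSpace.single i.succ (1 : ℝ) -
      WithLp.toLp 2 (Fin.cons 0 fun _ => s) ∈ V := by
    intro i
    have := V.add_mem (vsub_mem_vectorSpan ℝ (hy i) h) (V.smul_mem (x - y) e0)
    convert this using 1
    ext j
    refine Fin.cases ?_ (fun j => ?_) j
    · simp [axisPoint, prismPoint]
    · simp [axisPoint, prismPoint, Pi.single_apply]
  have eu : WithLp.toLp 2 (Fin.cons 0 fun _ => s) ∈ V := by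
    have := V.smul_mem (s / (t - k * s)) (V.sum_mem fun i (_ : i ∈ Finset.univ) => ed i)
    convert this using 1
    ext j
    refine Fin.cases ?_ (fun j => ?_) j
    · simp
    · simp [Pi.single_apply, div_mul_cancel₀ _ hs]
  rintro _ ⟨j, rfl⟩
  refine Fin.cases ?_ (fun j => ?_) j
  · simpa using e0
  · have := V.smul_mem t⁻¹ (V.add_mem (ed j) eu)
    simpa [smul_smul, ht] using this

/-- Abscissae of the collinear points of the construction. -/
def abscissae : Finset ℤ :=
  {-974, -502, -162, -25, 25, 261, 298, 774, 974, 1450, 1487, 1723, 1773, 1910, 2250, 2722}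

/-- Heights of the two bases of the prism. -/
def heights : Finset ℤ := {0, 1748}

lemma exists_sq_eq_of_mem_abscissae {x y : ℤ} (hx : x ∈ abscissae) (hy : y ∈ heights) :
    ∃ z : ℤ, 0 ≤ z ∧ z ≤ 3696 ∧ (x - y) ^ 2 + 554400 = z ^ 2 := by
  have key : ∀ x ∈ abscissae, ∀ y ∈ heights,
      Int.sqrt ((x - y) ^ 2 + 554400) ≤ 3696 ∧
        (x - y) ^ 2 + 554400 = Int.sqrt ((x - y) ^ 2 + 554400) ^ 2 := by
    decide +kernel
  exact ⟨_, Int.sqrt_nonneg _, key x hx y hy⟩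

lemma exists_sq_eq_of_mem_heights {x y : ℤ} (hx : x ∈ heights) (hy : y ∈ heights) :
    ∃ z : ℤ, 0 ≤ z ∧ z ≤ 3696 ∧ (x - y) ^ 2 + 336 ^ 2 = z ^ 2 := by
  have key : ∀ x ∈ heights, ∀ y ∈ heights,
      Int.sqrt ((x - y) ^ 2 + 336 ^ 2) ≤ 3696 ∧
        (x - y) ^ 2 + 336 ^ 2 = Int.sqrt ((x - y) ^ 2 + 336 ^ 2) ^ 2 := by
    decide +kernel
  exact ⟨_, Int.sqrt_nonneg _, key x hx y hy⟩

lemma abs_sub_le_of_mem_abscissae {x y : ℤ} (hx : x ∈ abscissae) (hy : y ∈ abscissae) :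
    |x - y| ≤ 3696 := by
  have key : ∀ x ∈ abscissae, ∀ y ∈ abscissae, |x - y| ≤ 3696 := by decide +kernel
  exact key x hx y hy

lemma abs_sub_le_of_mem_heights {x y : ℤ} (hx : x ∈ heights) (hy : y ∈ heights) :
    |x - y| ≤ 3696 := by
  have key : ∀ x ∈ heights, ∀ y ∈ heights, |x - y| ≤ 3696 := by decide +kernel
  exact key x hx y hy

/-- A point of the axis at squared distance `N` from all the vertices `t • e_i`. -/
lemma exists_axis_offset {k : ℕ} (hk : 1 ≤ k) {t N : ℝ} (hN : t ^ 2 < N) :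
    ∃ s : ℝ, k * s ^ 2 - 2 * t * s + t ^ 2 = N ∧ t - k * s ≠ 0 := by
  have hk' : (0 : ℝ) < k := by exact_mod_cast hk
  have hpos : 0 < t ^ 2 + k * (N - t ^ 2) := by
    have := mul_pos hk' (sub_pos.2 hN)
    positivity
  refine ⟨(t - √(t ^ 2 + k * (N - t ^ 2))) / k, ?_, ?_⟩
  · have hsq := Real.sq_sqrt hpos.le
    field_simp
    linear_combination hsq
  · rw [mul_div_cancel₀ _ hk'.ne', sub_sub_cancel]
    exact (Real.sqrt_pos.2 hpos).ne'

lemma exists_dist_eq_of_sq {k : ℕ} {p q : EuclideanSpace ℝ (Fin k)} {z : ℤ} (hz : 0 ≤ z)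
    (hz' : z ≤ 3696) (h : dist p q ^ 2 = (z : ℝ) ^ 2) :
    ∃ z : ℤ, dist p q = z ∧ z ≤ 3696 :=
  ⟨z, (sq_eq_sq₀ dist_nonneg (by exact_mod_cast hz)).1 h, hz'⟩

end IntegralPointSet

open IntegralPointSet in
/-- For every integer `m ≥ 2`, there exists an integral point set of `2 * m + 14` points in
`ℝ^m` (pairwise integral distances, not contained in any affine hyperplane) whose
diameter is at most `3696`; that is, `d(m, 2 * m + 14) ≤ 3696`. -/
theorem d_bound_stmt_16 :
    ∀ m : ℕ, 2 ≤ m →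
      ∃ S : Finset (EuclideanSpace ℝ (Fin m)),
        S.card = 2 * m + 14 ∧
        affineSpan ℝ (S : Set (EuclideanSpace ℝ (Fin m))) = ⊤ ∧
        (∀ p ∈ S, ∀ q ∈ S, ∃ z : ℤ, dist p q = (z : ℝ)) ∧
        Metric.diam (S : Set (EuclideanSpace ℝ (Fin m))) ≤ 3696 := by
  classical
  intro m hm
  obtain ⟨k, rfl⟩ : ∃ k, m = k + 1 := ⟨m - 1, by lia⟩
  have hk : 1 ≤ k := by lia
  obtain ⟨t, ht0, ht⟩ : ∃ t : ℝ, t ≠ 0 ∧ 2 * t ^ 2 = 336 ^ 2 :=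
    ⟨√56448, by positivity, by rw [Real.sq_sqrt] <;> norm_num⟩
  obtain ⟨s, hs, hts⟩ := exists_axis_offset hk (t := t) (N := 554400) (by linarith)
  set A : Finset (EuclideanSpace ℝ (Fin (k + 1))) :=
    abscissae.image fun x : ℤ => axisPoint k s x with hA
  set B : Finset (EuclideanSpace ℝ (Fin (k + 1))) :=
    (heights ×ˢ Finset.univ).image fun y : ℤ × Fin k => prismPoint t y.1 y.2 with hB
  have hAB : ∀ p ∈ A, ∀ q ∈ B, p ≠ q ∧ ∃ z : ℤ, dist p q = z ∧ z ≤ 3696 := by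
    simp only [hA, hB, Finset.forall_mem_image, Finset.mem_product, Finset.mem_univ, and_true,
      Prod.forall]
    intro x hx y i hy
    obtain ⟨z, hz, hz', h⟩ := exists_sq_eq_of_mem_abscissae hx hy
    have hd := dist_sq_axisPoint_prismPoint s t x y i
    rw [hs] at hd
    refine ⟨fun he => ?_, exists_dist_eq_of_sq hz hz' (hd.trans (by exact_mod_cast h))⟩
    rw [he, dist_self] at hd
    nlinarith [sq_nonneg ((x : ℝ) - y)]
  have hdist : ∀ p ∈ A ∪ B, ∀ q ∈ A ∪ B, ∃ z : ℤ, dist p q = z ∧ z ≤ 3696 := by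
    intro p hp q hq
    rcases Finset.mem_union.1 hp with hp | hp <;> rcases Finset.mem_union.1 hq with hq | hq
    · obtain ⟨x, hx, rfl⟩ := Finset.mem_image.1 hp
      obtain ⟨y, hy, rfl⟩ := Finset.mem_image.1 hq
      exact exists_dist_eq_of_sq (abs_nonneg _) (abs_sub_le_of_mem_abscissae hx hy)
        (by simp [dist_sq_axisPoint])
    · exact (hAB p hp q hq).2
    · rw [dist_comm]
      exact (hAB q hq p hp).2
    · obtain ⟨⟨x, i⟩, hx, rfl⟩ := Finset.mem_image.1 hp
      obtain ⟨⟨y, j⟩, hy, rfl⟩ := Finset.mem_image.1 hq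
      replace hx := (Finset.mem_product.1 hx).1
      replace hy := (Finset.mem_product.1 hy).1
      rcases eq_or_ne i j with rfl | hij
      · exact exists_dist_eq_of_sq (abs_nonneg _) (abs_sub_le_of_mem_heights hx hy)
          (by simp [dist_sq_prismPoint_self])
      · obtain ⟨z, hz, hz', h⟩ := exists_sq_eq_of_mem_heights hx hy
        refine exists_dist_eq_of_sq hz hz' ?_
        rw [dist_sq_prismPoint_of_ne t _ _ hij, ht]
        exact_mod_cast h
  refine ⟨A ∪ B, ?_, ?_, fun p hp q hq => (hdist p hp q hq).imp fun _ h => h.1, ?_⟩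
  · rw [Finset.card_union_of_disjoint
      (Finset.disjoint_left.2 fun p hp hq => (hAB p hp p hq).1 rfl), hA, hB,
      Finset.card_image_of_injective, Finset.card_image_of_injective, Finset.card_product,
      Finset.card_univ, Fintype.card_fin, show abscissae.card = 16 from rfl,
      show heights.card = 2 from rfl]
    · ring
    · rintro ⟨x, i⟩ ⟨y, j⟩ h
      simp only at h
      rcases eq_or_ne i j with rfl | hij
      · have hd := dist_sq_prismPoint_self t x y i
        rw [h, dist_self] at hd
        have : (x : ℝ) = y := sub_eq_zero.1 (pow_eq_zero_iff two_ne_zero |>.1 (by linarith))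
        exact Prod.ext (by exact_mod_cast this) rfl
      · have hd := dist_sq_prismPoint_of_ne t x y hij
        rw [h, dist_self] at hd
        nlinarith [sq_nonneg ((x : ℝ) - y)]
    · intro x y h
      have hd := dist_sq_axisPoint k s x y
      simp only at h
      rw [h, dist_self] at hd
      have : (x : ℝ) = y := sub_eq_zero.1 (pow_eq_zero_iff two_ne_zero |>.1 (by linarith))
      exact_mod_cast this
  · refine affineSpan_eq_top (x := (25 : ℤ)) (x' := (261 : ℤ)) (y := (0 : ℤ)) (by norm_num)
      ht0 hts ?_ ?_ fun i => ?_
    · exact Finset.mem_union_left _ (Finset.mem_image_of_mem _ (by decide))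
    · exact Finset.mem_union_left _ (Finset.mem_image_of_mem _ (by decide))
    · exact Finset.mem_union_right _ (Finset.mem_image.2 ⟨(0, i), by simp [heights], rfl⟩)
  · refine Metric.diam_le_of_forall_dist_le (by norm_num) fun p hp q hq => ?_
    obtain ⟨z, h, hz⟩ := hdist p hp q hq
    rw [h]
    exact_mod_cast hz
end

section
/- For every integer m ≥ 2, d(m, 2m + 15) ≤ 5141; that is, there exists an integral point set of 2m + 15 points in m-dimensional Euclidean space ℝ^m whose diameter is at most 5141. -/
namespace IntegralPointSet

/-- Seventeen integers `t` for which `t ^ 2 + 120 ^ 2` is a perfect square. -/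
def axisCoord : Fin 17 → ℤ :=
  ![0, 22, 27, 35, 50, 64, 90, 119, 126, -22, -27, -35, -50, -64, -90, -119, -126]

/-- The square roots of `axisCoord i ^ 2 + 120 ^ 2`. -/
def axisDist : Fin 17 → ℤ :=
  ![120, 122, 123, 125, 130, 136, 150, 169, 174, 122, 123, 125, 130, 136, 150, 169, 174]

theorem axisCoord_injective : Function.Injective axisCoord := by decide

theorem abs_axisCoord_le (i : Fin 17) : |axisCoord i| ≤ 126 := by
  revert i; decide

theorem axisDist_sq (i : Fin 17) : axisCoord i ^ 2 + 14400 = axisDist i ^ 2 := by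
  revert i; decide

theorem axisDist_bounds (i : Fin 17) : 0 < axisDist i ∧ axisDist i ≤ 5141 := by
  revert i; decide

/-- The sign attached to a Boolean. -/
def sign (b : Bool) : ℝ := if b then 1 else -1

theorem sign_sq (b : Bool) : sign b ^ 2 = 1 := by cases b <;> simp [sign]

/-- The vector of `ℝ ^ n` with all coordinates `u`, except that the `i`-th one is `s + u`. -/
def apex {n : ℕ} (s u : ℝ) (i : Fin n) : Fin n → ℝ := fun k => (if i = k then s else 0) + u

theorem sum_apex_mul {n : ℕ} (s u : ℝ) (i : Fin n) (x : Fin n → ℝ) :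
    ∑ k, apex s u i k * x k = s * x i + u * ∑ k, x k := by
  simp [apex, add_mul, Finset.sum_add_distrib, Finset.mul_sum]

theorem sum_apex {n : ℕ} (s u : ℝ) (i : Fin n) : ∑ k, apex s u i k = s + n * u := by
  simp [apex, Finset.sum_add_distrib]

/-- The points of the configuration in `ℝ ^ (n + 1)`: seventeen points on the first coordinate
axis, and the vectors `± apex s u i` in its orthogonal complement. -/
noncomputable def point {n : ℕ} (s u : ℝ) :
    Fin 17 ⊕ (Fin n × Bool) → EuclideanSpace ℝ (Fin (n + 1))
  | .inl i => WithLp.toLp 2 (Fin.cons (axisCoord i : ℝ) fun _ => 0)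
  | .inr (i, b) => WithLp.toLp 2 (Fin.cons 0 fun k => sign b * apex s u i k)

theorem dist_eq_intCast {E : Type*} [PseudoMetricSpace E] {x y : E} {z : ℤ} (hz : 0 ≤ z)
    (h : dist x y ^ 2 = (z : ℝ) ^ 2) : dist x y = z :=
  (sq_eq_sq₀ dist_nonneg (by exact_mod_cast hz)).1 h

theorem sum_apex_mul_apex {n : ℕ} {s u : ℝ} (hs : s ^ 2 = 10368)
    (hu : n * u ^ 2 + 2 * s * u = 4032) (i j : Fin n) :
    ∑ k, apex s u i k * apex s u j k = if i = j then 14400 else 4032 := by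
  rw [sum_apex_mul, sum_apex, apex]
  rcases eq_or_ne i j with rfl | h
  · simp only [if_true]; linear_combination hs + hu
  · simp only [h, h.symm, if_false]; linear_combination hu

theorem sum_sign_apex_sub_sq {n : ℕ} {s u : ℝ} (hs : s ^ 2 = 10368)
    (hu : n * u ^ 2 + 2 * s * u = 4032) (i j : Fin n) (b c : Bool) :
    ∑ k, (sign b * apex s u i k - sign c * apex s u j k) ^ 2 =
      28800 - 2 * sign b * sign c * (if i = j then 14400 else 4032) := by
  have expand (k : Fin n) : (sign b * apex s u i k - sign c * apex s u j k) ^ 2 =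
      apex s u i k * apex s u i k + apex s u j k * apex s u j k
        - 2 * sign b * sign c * (apex s u i k * apex s u j k) := by
    linear_combination apex s u i k ^ 2 * sign_sq b + apex s u j k ^ 2 * sign_sq c
  simp only [expand, Finset.sum_add_distrib, Finset.sum_sub_distrib, ← Finset.mul_sum,
    sum_apex_mul_apex hs hu, if_true]
  ring

theorem dist_point {n : ℕ} {s u : ℝ} (hs : s ^ 2 = 10368)
    (hu : n * u ^ 2 + 2 * s * u = 4032) (p q : Fin 17 ⊕ (Fin n × Bool)) :
    ∃ z : ℤ, dist (point s u p) (point s u q) = z ∧ z ≤ 5141 ∧ (z = 0 → p = q) := by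
  have mixed (i : Fin 17) (j : Fin n) (b : Bool) :
      dist (point s u (.inl i)) (point s u (.inr (j, b))) = axisDist i := by
    refine dist_eq_intCast (axisDist_bounds i).1.le ?_
    have hd : (axisCoord i : ℝ) ^ 2 + 14400 = (axisDist i : ℝ) ^ 2 := by
      exact_mod_cast axisDist_sq i
    have hself : ∑ k, (sign b * apex s u j k) ^ 2 = 14400 := by
      simp only [mul_pow, sign_sq, one_mul, pow_two (apex _ _ _ _), sum_apex_mul_apex hs hu,
        if_true]
    rw [EuclideanSpace.dist_eq, Real.sq_sqrt (by positivity), Fin.sum_univ_succ]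
    simp only [point, Real.dist_eq, sq_abs, Fin.cons_zero, Fin.cons_succ, sub_zero, zero_sub,
      neg_sq, hself, hd]
  rcases p with i | ⟨i, b⟩ <;> rcases q with j | ⟨j, c⟩
  · refine ⟨|axisCoord i - axisCoord j|, dist_eq_intCast (abs_nonneg _) ?_, ?_, fun h => ?_⟩
    · rw [EuclideanSpace.dist_eq, Real.sq_sqrt (by positivity), Fin.sum_univ_succ]
      simp [point, Real.dist_eq, sq_abs]
    · linarith [abs_sub (axisCoord i) (axisCoord j), abs_axisCoord_le i, abs_axisCoord_le j]
    · rw [axisCoord_injective (sub_eq_zero.1 (abs_eq_zero.1 h))]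
  · exact ⟨_, mixed i j c, (axisDist_bounds i).2, fun h => absurd h (axisDist_bounds i).1.ne'⟩
  · rw [dist_comm]
    exact ⟨_, mixed j i b, (axisDist_bounds j).2, fun h => absurd h (axisDist_bounds j).1.ne'⟩
  · have h := sum_sign_apex_sub_sq hs hu i j b c
    refine ⟨if i = j then (if b = c then 0 else 240) else (if b = c then 144 else 192),
      dist_eq_intCast (by split_ifs <;> norm_num) ?_, by split_ifs <;> norm_num, ?_⟩
    · rw [EuclideanSpace.dist_eq, Real.sq_sqrt (by positivity), Fin.sum_univ_succ]
      simp only [point, Real.dist_eq, sq_abs, Fin.cons_zero, Fin.cons_succ, h]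
      by_cases hij : i = j <;> cases b <;> cases c <;> simp [hij, sign] <;> norm_num
    · split_ifs <;> simp_all

theorem span_range_point {n : ℕ} {s u : ℝ} (hs : 0 < s) (hu : 0 ≤ u) :
    Submodule.span ℝ (Set.range (point (n := n) s u)) = ⊤ := by
  rw [← Submodule.orthogonal_eq_bot_iff, Submodule.eq_bot_iff]
  intro x hx
  have horth (p) : inner ℝ (point s u p) x = 0 :=
    (Submodule.mem_orthogonal _ _).1 hx _ (Submodule.subset_span ⟨p, rfl⟩)
  have hzero : x 0 = 0 := by
    have h := horth (.inl 1)
    rw [PiLp.inner_apply, Fin.sum_univ_succ] at h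
    simpa [point, axisCoord] using h
  have hsucc (i : Fin n) : s * x i.succ + u * ∑ k : Fin n, x k.succ = 0 := by
    have h := horth (.inr (i, true))
    rw [PiLp.inner_apply, Fin.sum_univ_succ] at h
    rw [← sum_apex_mul s u i fun k => x k.succ]
    simpa [point, sign, mul_comm] using h
  have hsum : ∑ k : Fin n, x k.succ = 0 := by
    have h : ∑ i : Fin n, (s * x i.succ + u * ∑ k : Fin n, x k.succ) = 0 :=
      Finset.sum_eq_zero fun i _ => hsucc i
    rw [Finset.sum_add_distrib, ← Finset.mul_sum, Finset.sum_const, Finset.card_univ,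
      Fintype.card_fin, nsmul_eq_mul] at h
    have h' : (s + n * u) * ∑ k : Fin n, x k.succ = 0 := by linear_combination h
    exact (mul_eq_zero.1 h').resolve_left (by positivity)
  ext k
  refine Fin.cases hzero (fun i => ?_) k
  have h := hsucc i
  rw [hsum, mul_zero, add_zero] at h
  exact (mul_eq_zero.1 h).resolve_left hs.ne'

theorem affineSpan_range_point {n : ℕ} {s u : ℝ} (hs : 0 < s) (hu : 0 ≤ u) :
    affineSpan ℝ (Set.range (point (n := n) s u)) = ⊤ := by
  have hmem : (0 : EuclideanSpace ℝ (Fin (n + 1))) ∈ Set.range (point (n := n) s u) := by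
    refine ⟨.inl 0, ?_⟩
    ext k
    refine Fin.cases ?_ (fun i => ?_) k <;> simp [point, axisCoord]
  rw [← Set.insert_eq_of_mem hmem]
  apply SetLike.coe_injective
  rw [affineSpan_insert_zero, span_range_point hs hu]
  simp

theorem exists_nonneg_root (n : ℕ) {s c : ℝ} (hs : 0 < s) (hc : 0 ≤ c) :
    ∃ u : ℝ, 0 ≤ u ∧ n * u ^ 2 + 2 * s * u = c := by
  have hmem : c ∈ Set.Icc (n * (0 : ℝ) ^ 2 + 2 * s * 0)
      (n * (c / (2 * s)) ^ 2 + 2 * s * (c / (2 * s))) := by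
    refine ⟨by simpa using hc, ?_⟩
    rw [mul_div_cancel₀ c (by positivity : 2 * s ≠ 0)]
    nlinarith [show (0 : ℝ) ≤ n * (c / (2 * s)) ^ 2 by positivity]
  obtain ⟨u, hu, h⟩ := intermediate_value_Icc (f := fun u : ℝ => n * u ^ 2 + 2 * s * u)
    (by positivity : (0 : ℝ) ≤ c / (2 * s)) (by fun_prop) hmem
  exact ⟨u, hu.1, h⟩

end IntegralPointSet

open IntegralPointSet in
/-- For every integer `m ≥ 2`, there exists an integral point set of `2 * m + 15` points in
`ℝ^m` (pairwise integral distances, not contained in any affine hyperplane) whose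
diameter is at most `5141`; that is, `d(m, 2 * m + 15) ≤ 5141`. -/
theorem d_bound_stmt_17 :
    ∀ m : ℕ, 2 ≤ m →
      ∃ S : Finset (EuclideanSpace ℝ (Fin m)),
        S.card = 2 * m + 15 ∧
        affineSpan ℝ (S : Set (EuclideanSpace ℝ (Fin m))) = ⊤ ∧
        (∀ p ∈ S, ∀ q ∈ S, ∃ z : ℤ, dist p q = (z : ℝ)) ∧
        Metric.diam (S : Set (EuclideanSpace ℝ (Fin m))) ≤ 5141 := by
  intro m hm
  obtain ⟨n, rfl⟩ : ∃ n, m = n + 1 := ⟨m - 1, by omega⟩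
  have hs : (0 : ℝ) < √10368 := by positivity
  have hsq : √10368 ^ 2 = (10368 : ℝ) := Real.sq_sqrt (by norm_num)
  obtain ⟨u, hu, hroot⟩ := exists_nonneg_root n hs (by norm_num : (0 : ℝ) ≤ 4032)
  have hdist := dist_point hsq hroot
  have hinj : Function.Injective (point (n := n) √10368 u) := fun p q hpq => by
    obtain ⟨z, hz, -, h⟩ := hdist p q
    rw [hpq, dist_self] at hz
    exact h (by exact_mod_cast hz.symm)
  refine ⟨Finset.univ.map ⟨_, hinj⟩, ?_, ?_, ?_, ?_⟩
  · simp; omega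
  · simpa using affineSpan_range_point hs hu
  · simp only [Finset.mem_map, Finset.mem_univ, true_and, Function.Embedding.coeFn_mk]
    rintro _ ⟨p, rfl⟩ _ ⟨q, rfl⟩
    obtain ⟨z, hz, -⟩ := hdist p q
    exact ⟨z, hz⟩
  · refine Metric.diam_le_of_forall_dist_le (by norm_num) ?_
    simp only [Finset.coe_map, Finset.coe_univ, Set.image_univ, Function.Embedding.coeFn_mk]
    rintro _ ⟨p, rfl⟩ _ ⟨q, rfl⟩
    obtain ⟨z, hz, hle, -⟩ := hdist p q
    rw [hz]
    exact_mod_cast hle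
end
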